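/- arXiv:2501.10090 — 3 statements merged into one kernel-verified Lean document; each statement's English description precedes it below -/
import Mathlib

section
/- For every integer n ≥ 1, the triple integrals I₃(n) = ∭_{[0,1]³} x^{n-1/2}(1-x)^{n-1/2} y^{n-1/2}(1-y)^{n-1/2} z^{n-1/2}(1-z)^{n-1/2}/(1-(1-xy)z)^{n+1/2} dx dy dz satisfy the three-term recurrence (2n+1)³·I₃(n+1) = 4n(68n² + 3)·I₃(n) - (2n-1)³·I₃(n-1). -/
open MeasureTheory

/-- The Beukers-type triple integral
`I₃(n) = ∭_{[0,1]³} (x(1-x)y(1-y)z(1-z))^{n-1/2}·(1-(1-xy)z)^{-(n+1/2)} dx dy dz`. -/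
noncomputable def I₃ (n : ℕ) : ℝ :=
  ∫ p in Set.Ioo (0 : ℝ) 1 ×ˢ Set.Ioo (0 : ℝ) 1 ×ˢ Set.Ioo (0 : ℝ) 1,
    p.1 ^ ((n : ℝ) - 1 / 2) * (1 - p.1) ^ ((n : ℝ) - 1 / 2) *
      p.2.1 ^ ((n : ℝ) - 1 / 2) * (1 - p.2.1) ^ ((n : ℝ) - 1 / 2) *
      p.2.2 ^ ((n : ℝ) - 1 / 2) * (1 - p.2.2) ^ ((n : ℝ) - 1 / 2) /
      (1 - (1 - p.1 * p.2.1) * p.2.2) ^ ((n : ℝ) + 1 / 2)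

open Set Filter Topology

lemma integrableOn_rpow_mul_one_sub_rpow {p q : ℝ} (hp : -1 < p) (hq : -1 < q) :
    IntegrableOn (fun z : ℝ => z ^ p * (1 - z) ^ q) (Ioo 0 1) := by
  have h := Complex.betaIntegral_convergent (u := ((p + 1 : ℝ) : ℂ)) (v := ((q + 1 : ℝ) : ℂ))
    (by simpa using by linarith) (by simpa using by linarith)
  rw [intervalIntegrable_iff_integrableOn_Ioo_of_le zero_le_one] at h
  refine h.re.congr ((ae_restrict_mem measurableSet_Ioo).mono fun z hz => ?_)
  have h1 : ((p + 1 : ℝ) : ℂ) - 1 = (p : ℂ) := by push_cast; ring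
  have h2 : ((q + 1 : ℝ) : ℂ) - 1 = (q : ℂ) := by push_cast; ring
  have h3 : (1 : ℂ) - z = ((1 - z : ℝ) : ℂ) := by push_cast; ring
  simp only [h1, h2, h3, ← Complex.ofReal_cpow hz.1.le, ← Complex.ofReal_cpow (sub_pos.2 hz.2).le,
    ← Complex.ofReal_mul]
  simp

lemma one_sub_mul_pos {t z : ℝ} (ht : 0 < t) (hz : z ∈ Icc (0 : ℝ) 1) :
    0 < 1 - (1 - t) * z := by
  nlinarith [hz.1, hz.2, mul_nonneg hz.1 ht.le, mul_pos ht ht]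

lemma min_le_one_sub_mul {t z : ℝ} (hz : z ∈ Icc (0 : ℝ) 1) :
    min 1 t ≤ 1 - (1 - t) * z := by
  rcases le_total 1 t with h | h
  · rw [min_eq_left h]; nlinarith [hz.1, hz.2]
  · rw [min_eq_right h]; nlinarith [hz.1, hz.2]

/-- The integrand of Euler's integral for the hypergeometric function. -/
noncomputable def eulerIntegrand (p q r t z : ℝ) : ℝ :=
  z ^ p * (1 - z) ^ q / (1 - (1 - t) * z) ^ r

lemma measurable_eulerIntegrand (p q r : ℝ) :
    Measurable fun x : ℝ × ℝ => eulerIntegrand p q r x.1 x.2 := by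
  unfold eulerIntegrand
  fun_prop

lemma eulerIntegrand_nonneg {p q r t z : ℝ} (ht : 0 < t) (hz : z ∈ Ioo (0 : ℝ) 1) :
    0 ≤ eulerIntegrand p q r t z := by
  have h1 := hz.1
  have h2 := sub_pos.2 hz.2
  have h3 := one_sub_mul_pos ht (Ioo_subset_Icc_self hz)
  unfold eulerIntegrand
  positivity

lemma eulerIntegrand_le {p q r s t z : ℝ} (hr : 0 ≤ r) (hs : 0 < s) (hst : s ≤ t) (hs1 : s ≤ 1)
    (hz : z ∈ Ioo (0 : ℝ) 1) :
    eulerIntegrand p q r t z ≤ (s ^ r)⁻¹ * (z ^ p * (1 - z) ^ q) := by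
  have h1 := hz.1
  have h2 := sub_pos.2 hz.2
  have h3 : s ≤ 1 - (1 - t) * z :=
    (le_min hs1 hst).trans (min_le_one_sub_mul (Ioo_subset_Icc_self hz))
  unfold eulerIntegrand
  rw [div_eq_inv_mul]
  gcongr

lemma integrableOn_eulerIntegrand {p q r t : ℝ} (hp : -1 < p) (hq : -1 < q) (hr : 0 ≤ r)
    (ht : 0 < t) : IntegrableOn (eulerIntegrand p q r t) (Ioo 0 1) := by
  refine ((integrableOn_rpow_mul_one_sub_rpow hp hq).const_mul ((min 1 t) ^ r)⁻¹).mono'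
    ((measurable_eulerIntegrand p q r).comp measurable_prodMk_left).aestronglyMeasurable
    ((ae_restrict_mem measurableSet_Ioo).mono fun z hz => ?_)
  rw [Real.norm_of_nonneg (eulerIntegrand_nonneg ht hz)]
  exact eulerIntegrand_le hr (lt_min one_pos ht) (min_le_right _ _) (min_le_left _ _) hz

/-- The integral `∫₀¹ (z(1-z))^m (1-(1-t)z)^{-(m+1)} dz`, which is, up to an elementary factor,
the Legendre function of the second kind `Q_m((1+t)/(1-t))`. -/
noncomputable def legendreIntegral (m t : ℝ) : ℝ :=
  ∫ z in Ioo (0 : ℝ) 1, eulerIntegrand m m (m + 1) t z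

lemma legendreIntegral_nonneg {m t : ℝ} (ht : 0 < t) : 0 ≤ legendreIntegral m t :=
  setIntegral_nonneg measurableSet_Ioo fun _ hz => eulerIntegrand_nonneg ht hz

lemma exists_legendreIntegral_le {m δ : ℝ} (hδ : 0 < δ) (hm : δ < m + 1) :
    ∃ C, ∀ t, 0 < t → legendreIntegral m t ≤ C * t ^ (-δ) := by
  refine ⟨∫ z in Ioo (0 : ℝ) 1, z ^ (m - δ) * (1 - z) ^ (δ - 1), fun t ht => ?_⟩
  rw [mul_comm, ← integral_const_mul]
  refine setIntegral_mono_on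
    (integrableOn_eulerIntegrand (by linarith) (by linarith) (by linarith) ht)
    ((integrableOn_rpow_mul_one_sub_rpow (by linarith) (by linarith)).const_mul _)
    measurableSet_Ioo fun z hz => ?_
  have h1 := hz.1
  have h2 := sub_pos.2 hz.2
  have h3 := one_sub_mul_pos ht (Ioo_subset_Icc_self hz)
  have key : (t * z) ^ δ * (1 - z) ^ (m + 1 - δ) ≤ (1 - (1 - t) * z) ^ (m + 1) := by
    have hsum : (1 - (1 - t) * z) ^ (m + 1) =
        (1 - (1 - t) * z) ^ δ * (1 - (1 - t) * z) ^ (m + 1 - δ) := by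
      rw [← Real.rpow_add h3]; ring_nf
    have : 0 ≤ m + 1 - δ := by linarith
    rw [hsum]
    gcongr
    · linarith
    · nlinarith
  unfold eulerIntegrand
  calc z ^ m * (1 - z) ^ m / (1 - (1 - t) * z) ^ (m + 1)
      ≤ z ^ m * (1 - z) ^ m / ((t * z) ^ δ * (1 - z) ^ (m + 1 - δ)) := by gcongr
    _ = t ^ (-δ) * (z ^ (m - δ) * (1 - z) ^ (δ - 1)) := by
      rw [Real.mul_rpow ht.le h1.le, Real.rpow_neg ht.le, Real.rpow_sub h1, Real.rpow_sub h2,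
        Real.rpow_sub h2, Real.rpow_add h2]
      simp only [Real.rpow_one]
      field_simp

lemma hasDerivAt_legendreIntegral {m t : ℝ} (hm : -1 < m) (ht : 0 < t) :
    HasDerivAt (legendreIntegral m)
      (∫ z in Ioo (0 : ℝ) 1, -(m + 1) * eulerIntegrand (m + 1) m (m + 2) t z) t := by
  have hs : 0 < min 1 (t / 2) := lt_min one_pos (half_pos ht)
  refine (hasDerivAt_integral_of_dominated_loc_of_deriv_le
    (μ := volume.restrict (Ioo (0 : ℝ) 1)) (s := Ioi (t / 2))
    (F := fun t z => eulerIntegrand m m (m + 1) t z)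
    (F' := fun t z => -(m + 1) * eulerIntegrand (m + 1) m (m + 2) t z)
    (bound := fun z => (m + 1) * (((min 1 (t / 2)) ^ (m + 2))⁻¹ * (z ^ (m + 1) * (1 - z) ^ m)))
    (Ioi_mem_nhds (half_lt_self ht))
    (Eventually.of_forall fun x =>
      ((measurable_eulerIntegrand _ _ _).comp measurable_prodMk_left).aestronglyMeasurable)
    (integrableOn_eulerIntegrand hm hm (by linarith) ht)
    ((((measurable_eulerIntegrand _ _ _).comp
      measurable_prodMk_left).aestronglyMeasurable).const_mul _)
    ((ae_restrict_mem measurableSet_Ioo).mono fun z hz x hx => ?_)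
    (((integrableOn_rpow_mul_one_sub_rpow (by linarith) hm).const_mul _).const_mul _)
    ((ae_restrict_mem measurableSet_Ioo).mono fun z hz x hx => ?_)).2
  · have hx0 : 0 < x := (half_pos ht).trans hx
    rw [norm_mul, norm_neg, Real.norm_of_nonneg (by linarith : 0 ≤ m + 1),
      Real.norm_of_nonneg (eulerIntegrand_nonneg hx0 hz)]
    have : 0 ≤ m + 1 := by linarith
    gcongr
    exact eulerIntegrand_le (by linarith) hs ((min_le_right _ _).trans (le_of_lt hx))
      (min_le_left _ _) hz
  · have hx0 : 0 < x := (half_pos ht).trans hx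
    have h1 := hz.1
    have h3 := one_sub_mul_pos hx0 (Ioo_subset_Icc_self hz)
    have hd : HasDerivAt (fun x => 1 - (1 - x) * z) z x := by
      simpa using (((hasDerivAt_id x).const_sub 1).mul_const z).const_sub 1
    have := ((hd.rpow_const (p := m + 1) (Or.inl h3.ne')).fun_inv (by positivity)).const_mul
      (z ^ m * (1 - z) ^ m)
    unfold eulerIntegrand
    simp only [div_eq_mul_inv]
    convert! this using 1
    rw [show m + 2 = m + 1 + 1 by ring, Real.rpow_sub_one h3.ne', Real.rpow_add_one h3.ne' (m + 1),
      Real.rpow_add_one h1.ne']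
    field_simp

lemma setIntegral_sub_add_eq_zero_of_hasDerivAt {H f g k : ℝ → ℝ}
    (hc : ContinuousOn H (Icc 0 1)) (hd : ∀ z ∈ Ioo (0 : ℝ) 1, HasDerivAt H (f z - g z + k z) z)
    (hf : IntegrableOn f (Ioo 0 1)) (hg : IntegrableOn g (Ioo 0 1))
    (hk : IntegrableOn k (Ioo 0 1)) (h0 : H 0 = 0) (h1 : H 1 = 0) :
    (∫ z in Ioo (0 : ℝ) 1, f z) - (∫ z in Ioo (0 : ℝ) 1, g z) + ∫ z in Ioo (0 : ℝ) 1, k z = 0 := by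
  have hfg : IntegrableOn (fun z => f z - g z) (Ioo 0 1) := hf.sub hg
  have hi : IntegrableOn (fun z => f z - g z + k z) (Ioo 0 1) := hfg.add hk
  rw [← integral_sub hf hg, ← integral_add hfg hk, ← integral_Ioc_eq_integral_Ioo,
    ← intervalIntegral.integral_of_le zero_le_one,
    intervalIntegral.integral_eq_sub_of_hasDerivAt_of_le zero_le_one hc hd
      ((intervalIntegrable_iff_integrableOn_Ioo_of_le zero_le_one).2 hi), h0, h1, sub_zero]

lemma continuousOn_eulerIntegrand {p q r t : ℝ} (hp : 0 ≤ p) (hq : 0 ≤ q) (ht : 0 < t) :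
    ContinuousOn (eulerIntegrand p q r t) (Icc 0 1) := by
  unfold eulerIntegrand
  refine ContinuousOn.div ?_ ?_ fun z hz => (Real.rpow_pos_of_pos (one_sub_mul_pos ht hz) _).ne'
  · exact ((Real.continuous_rpow_const hp).mul
      ((Real.continuous_rpow_const hq).comp (by fun_prop))).continuousOn
  · exact ContinuousOn.rpow_const (by fun_prop) fun z hz => Or.inl (one_sub_mul_pos ht hz).ne'

lemma hasDerivAt_eulerIntegrand {p q r t z : ℝ} (ht : 0 < t) (hz : z ∈ Ioo (0 : ℝ) 1) :
    HasDerivAt (eulerIntegrand p q r t)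
      (eulerIntegrand p q r t z * (p / z - q / (1 - z) + r * (1 - t) / (1 - (1 - t) * z))) z := by
  have h1 := hz.1
  have h2 := sub_pos.2 hz.2
  have h3 := one_sub_mul_pos ht (Ioo_subset_Icc_self hz)
  have d1 := (hasDerivAt_id z).rpow_const (p := p) (Or.inl h1.ne')
  have d2 := ((hasDerivAt_id z).const_sub 1).rpow_const (p := q) (Or.inl h2.ne')
  have d3 := (((hasDerivAt_id z).const_mul (1 - t)).const_sub 1).rpow_const (p := r)
    (Or.inl h3.ne')
  have := (d1.fun_mul d2).fun_div d3 (by simp only [id]; positivity)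
  unfold eulerIntegrand
  simp only [id] at this
  convert! this using 1
  rw [Real.rpow_sub_one h1.ne', Real.rpow_sub_one h2.ne', Real.rpow_sub_one h3.ne']
  field_simp
  ring

lemma legendreIntegral_deriv_eq {m t : ℝ} (hm : -1 < m) (ht : 0 < t) :
    2 * t * (∫ z in Ioo (0 : ℝ) 1, -(m + 1) * eulerIntegrand (m + 1) m (m + 2) t z) =
      (m + 1) * ((1 - t) * legendreIntegral (m + 1) t - legendreIntegral m t) := by
  have hm' : (0 : ℝ) < m + 1 := by linarith
  have i1 := integrableOn_eulerIntegrand (p := m + 1) (q := m) (r := m + 2) (by linarith) hm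
    (by linarith) ht
  have i2 := integrableOn_eulerIntegrand (p := m + 1) (q := m + 1) (r := m + 1 + 1) (by linarith)
    (by linarith) (by linarith) ht
  have i3 := integrableOn_eulerIntegrand (p := m) (q := m) (r := m + 1) hm hm (by linarith) ht
  have j1 := (i1.const_mul (-(m + 1))).const_mul (2 * t)
  have j2 := (i2.const_mul (1 - t)).const_mul (m + 1)
  have j3 := i3.const_mul (m + 1)
  have key := setIntegral_sub_add_eq_zero_of_hasDerivAt
    (H := eulerIntegrand (m + 1) (m + 1) (m + 1) t)
    (continuousOn_eulerIntegrand hm'.le hm'.le ht)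
    (fun z hz => by
      have h1 := hz.1
      have h2 := sub_pos.2 hz.2
      have h3 := one_sub_mul_pos ht (Ioo_subset_Icc_self hz)
      convert! hasDerivAt_eulerIntegrand ht hz using 1
      unfold eulerIntegrand
      rw [show m + 2 = m + 1 + 1 by ring, Real.rpow_add_one h3.ne' (m + 1),
        Real.rpow_add_one h3.ne' m, Real.rpow_add_one h1.ne', Real.rpow_add_one h2.ne']
      generalize hD : 1 - (1 - t) * z = D at h3 ⊢
      field_simp
      rw [← hD]
      ring)
    j1 j2 j3
    (by simp [eulerIntegrand, Real.zero_rpow hm'.ne'])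
    (by simp [eulerIntegrand, Real.zero_rpow hm'.ne'])
  simp only [integral_const_mul] at key
  unfold legendreIntegral
  rw [integral_const_mul]
  linarith

lemma hasDerivAt_legendreIntegral_left {m t : ℝ} (hm : -1 < m) (ht : 0 < t) :
    HasDerivAt (legendreIntegral m)
      ((m + 1) * ((1 - t) * legendreIntegral (m + 1) t - legendreIntegral m t) / (2 * t)) t := by
  convert! hasDerivAt_legendreIntegral hm ht using 1
  rw [← legendreIntegral_deriv_eq hm ht]
  field_simp

lemma legendreIntegral_three_term {m t : ℝ} (hm : 0 < m) (ht : 0 < t) :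
    (m + 1) * (1 - t) ^ 2 * legendreIntegral (m + 1) t =
      (2 * m + 1) * (1 + t) * legendreIntegral m t - m * legendreIntegral (m - 1) t := by
  have i1 := integrableOn_eulerIntegrand (p := m + 1) (q := m + 1) (r := m + 1 + 1) (by linarith)
    (by linarith) (by linarith) ht
  have i2 := integrableOn_eulerIntegrand (p := m) (q := m) (r := m + 1) (by linarith)
    (by linarith) (by linarith) ht
  have i3 := integrableOn_eulerIntegrand (p := m - 1) (q := m - 1) (r := m - 1 + 1) (by linarith)
    (by linarith) (by linarith) ht
  have j1 := i1.const_mul ((m + 1) * (1 - t) ^ 2)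
  have j2 := i2.const_mul ((2 * m + 1) * (1 + t))
  have j3 := i3.const_mul m
  have key := setIntegral_sub_add_eq_zero_of_hasDerivAt
    (H := fun z => eulerIntegrand m m (m + 1) t z * (1 - 2 * z + (1 - t) * z ^ 2))
    ((continuousOn_eulerIntegrand hm.le hm.le ht).mul (by fun_prop))
    (fun z hz => by
      have h1 := hz.1
      have h2 := sub_pos.2 hz.2
      have h3 := one_sub_mul_pos ht (Ioo_subset_Icc_self hz)
      have hg : HasDerivAt (fun z : ℝ => 1 - 2 * z + (1 - t) * z ^ 2)
          (-2 + (1 - t) * (2 * z)) z := by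
        have := (((hasDerivAt_id z).const_mul 2).const_sub 1).fun_add
          (((hasDerivAt_id z).fun_pow 2).const_mul (1 - t))
        simpa using this
      convert! (hasDerivAt_eulerIntegrand ht hz).fun_mul hg using 1
      unfold eulerIntegrand
      rw [Real.rpow_add_one h3.ne' (m + 1), sub_add_cancel, Real.rpow_add_one h3.ne' m,
        Real.rpow_add_one h1.ne', Real.rpow_add_one h2.ne', Real.rpow_sub_one h1.ne',
        Real.rpow_sub_one h2.ne']
      generalize hD : 1 - (1 - t) * z = D at h3 ⊢
      field_simp
      rw [← hD]
      ring)
    j1 j2 j3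
    (by simp [eulerIntegrand, Real.zero_rpow hm.ne'])
    (by simp [eulerIntegrand, Real.zero_rpow hm.ne'])
  simp only [integral_const_mul] at key
  unfold legendreIntegral
  linarith

lemma hasDerivAt_legendreIntegral_right {m t : ℝ} (hm : 0 < m) (ht : t ∈ Ioo (0 : ℝ) 1) :
    HasDerivAt (legendreIntegral m)
      (((2 * t * (m + 1) + m * (1 + t)) * legendreIntegral m t -
        m * legendreIntegral (m - 1) t) / (2 * t * (1 - t))) t := by
  have h1 := ht.1
  have h2 := sub_pos.2 ht.2
  convert! hasDerivAt_legendreIntegral_left (by linarith : -1 < m) ht.1 using 1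
  field_simp
  linear_combination -legendreIntegral_three_term hm ht.1

lemma continuousOn_legendreIntegral {m : ℝ} (hm : -1 < m) :
    ContinuousOn (legendreIntegral m) (Ioo 0 1) := fun _ ht =>
  (hasDerivAt_legendreIntegral hm ht.1).continuousAt.continuousWithinAt

/-- The weighted square of `legendreIntegral m`, whose integral over `(0, 1)` is the Beukers-type
triple integral of exponent `m`. -/
noncomputable def squareIntegrand (m t : ℝ) : ℝ :=
  t ^ m * (1 - t) ^ (2 * m + 1) * legendreIntegral m t ^ 2

lemma squareIntegrand_nonneg {m t : ℝ} (ht : t ∈ Ioo (0 : ℝ) 1) : 0 ≤ squareIntegrand m t := by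
  have h1 := ht.1
  have h2 := sub_pos.2 ht.2
  unfold squareIntegrand
  positivity

lemma aestronglyMeasurable_squareIntegrand {m : ℝ} (hm : -1 < m) :
    AEStronglyMeasurable (squareIntegrand m) (volume.restrict (Ioo 0 1)) := by
  refine AEStronglyMeasurable.mul (Measurable.aestronglyMeasurable (by fun_prop)) ?_
  exact ((continuousOn_legendreIntegral hm).pow 2).aestronglyMeasurable measurableSet_Ioo

lemma integrableOn_squareIntegrand {m : ℝ} (hm : -1 < m) :
    IntegrableOn (squareIntegrand m) (Ioo 0 1) := by
  obtain ⟨C, hC⟩ := exists_legendreIntegral_le (m := m) (δ := (m + 1) / 4) (by linarith)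
    (by linarith)
  refine ((integrableOn_rpow_mul_one_sub_rpow (p := (m - 1) / 2) (q := 2 * m + 1) (by linarith)
    (by linarith)).const_mul (C ^ 2)).mono' (aestronglyMeasurable_squareIntegrand hm)
    ((ae_restrict_mem measurableSet_Ioo).mono fun t ht => ?_)
  rw [Real.norm_of_nonneg (squareIntegrand_nonneg ht)]
  have h1 := ht.1
  have h2 := sub_pos.2 ht.2
  have h3 := hC t h1
  have h4 := legendreIntegral_nonneg (m := m) h1
  calc squareIntegrand m t
      ≤ t ^ m * (1 - t) ^ (2 * m + 1) * (C * t ^ (-((m + 1) / 4))) ^ 2 := by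
        unfold squareIntegrand
        gcongr
    _ = C ^ 2 * (t ^ ((m - 1) / 2) * (1 - t) ^ (2 * m + 1)) := by
        rw [show (m - 1) / 2 = m + -((m + 1) / 4) + -((m + 1) / 4) by ring, Real.rpow_add h1,
          Real.rpow_add h1]
        ring

/-- The quadratic form in `u = legendreIntegral m t` and `v = legendreIntegral (m - 1) t` that
certifies the recurrence. -/
noncomputable def certificateForm (m t u v : ℝ) : ℝ :=
  (m ^ 2 / 2 - (31 / 2 * m ^ 2 + 17 * m + 5) * t + (59 / 2 * m ^ 2 + 30 * m + 8) * t ^ 2 -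
      (13 / 2 * m ^ 2 + 5 * m + 1) * t ^ 3) * u ^ 2 +
    (-2 * m ^ 2 - (10 * m ^ 2 + 5 * m) * t + (8 * m ^ 2 + 3 * m) * t ^ 2) * (u * v) +
    5 / 2 * m ^ 2 * (1 - t) * v ^ 2

/-- An antiderivative of the recurrence operator applied to `squareIntegrand`. -/
noncomputable def certificate (m t : ℝ) : ℝ :=
  t ^ m * (1 - t) ^ (2 * m) *
    certificateForm m t (legendreIntegral m t) (legendreIntegral (m - 1) t)

lemma hasDerivAt_certificate {m t : ℝ} (hm : 0 < m) (ht : t ∈ Ioo (0 : ℝ) 1) :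
    HasDerivAt (certificate m)
      ((m + 1) ^ 3 * squareIntegrand (m + 1) t -
        (2 * m + 1) * (17 * m ^ 2 + 17 * m + 5) * squareIntegrand m t +
        m ^ 3 * squareIntegrand (m - 1) t) t := by
  have h1 := ht.1
  have h2 := sub_pos.2 ht.2
  have hu := hasDerivAt_legendreIntegral_right hm ht
  have hv := hasDerivAt_legendreIntegral_left (by linarith : -1 < m - 1) h1
  have hw : legendreIntegral (m + 1) t = ((2 * m + 1) * (1 + t) * legendreIntegral m t -
      m * legendreIntegral (m - 1) t) / ((m + 1) * (1 - t) ^ 2) := by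
    rw [eq_div_iff (by positivity), ← legendreIntegral_three_term hm h1]
    ring
  simp only [sub_add_cancel] at hv
  have d1 := (hasDerivAt_id t).rpow_const (p := m) (Or.inl h1.ne')
  have d2 := ((hasDerivAt_id t).const_sub 1).rpow_const (p := 2 * m) (Or.inl h2.ne')
  have dA : HasDerivAt (fun t : ℝ => m ^ 2 / 2 - (31 / 2 * m ^ 2 + 17 * m + 5) * t +
      (59 / 2 * m ^ 2 + 30 * m + 8) * t ^ 2 - (13 / 2 * m ^ 2 + 5 * m + 1) * t ^ 3)
      (-(31 / 2 * m ^ 2 + 17 * m + 5) + (59 / 2 * m ^ 2 + 30 * m + 8) * (2 * t) -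
        (13 / 2 * m ^ 2 + 5 * m + 1) * (3 * t ^ 2)) t := by
    have := ((((hasDerivAt_id t).const_mul (31 / 2 * m ^ 2 + 17 * m + 5)).const_sub
      (m ^ 2 / 2)).fun_add (((hasDerivAt_id t).fun_pow 2).const_mul
      (59 / 2 * m ^ 2 + 30 * m + 8))).fun_sub
      (((hasDerivAt_id t).fun_pow 3).const_mul (13 / 2 * m ^ 2 + 5 * m + 1))
    simpa using this
  have dB : HasDerivAt (fun t : ℝ => -2 * m ^ 2 - (10 * m ^ 2 + 5 * m) * t +
      (8 * m ^ 2 + 3 * m) * t ^ 2)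
      (-(10 * m ^ 2 + 5 * m) + (8 * m ^ 2 + 3 * m) * (2 * t)) t := by
    have := (((hasDerivAt_id t).const_mul (10 * m ^ 2 + 5 * m)).const_sub
      (-2 * m ^ 2)).fun_add (((hasDerivAt_id t).fun_pow 2).const_mul (8 * m ^ 2 + 3 * m))
    simpa using this
  have dC : HasDerivAt (fun t : ℝ => 5 / 2 * m ^ 2 * (1 - t)) (-(5 / 2 * m ^ 2)) t := by
    simpa using ((hasDerivAt_id t).const_sub 1).const_mul (5 / 2 * m ^ 2)
  have := (d1.fun_mul d2).fun_mul (((dA.fun_mul (hu.fun_pow 2)).fun_add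
    (dB.fun_mul (hu.fun_mul hv))).fun_add (dC.fun_mul (hv.fun_pow 2)))
  unfold certificate certificateForm squareIntegrand
  simp only [id] at this
  convert! this using 1
  rw [hw, Real.rpow_add_one h1.ne', Real.rpow_sub_one h1.ne', Real.rpow_sub_one h2.ne',
    show 2 * (m + 1) + 1 = 2 * m + 1 + 1 + 1 by ring, show 2 * (m - 1) + 1 = 2 * m - 1 by ring,
    Real.rpow_sub_one h2.ne', Real.rpow_add_one h2.ne', Real.rpow_add_one h2.ne',
    Real.rpow_add_one h2.ne']
  generalize legendreIntegral m t = u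
  generalize legendreIntegral (m - 1) t = v
  generalize t ^ m = a
  generalize (1 - t) ^ (2 * m) = b
  have hm1 : m + 1 ≠ 0 := by positivity
  have h2' := h2.ne'
  field_simp
  push_cast
  ring

lemma exists_abs_certificate_le {m : ℝ} (hm : 0 < m) :
    ∃ K, ∀ t ∈ Ioo (0 : ℝ) 1, |certificate m t| ≤ t ^ (m / 2) * (1 - t) ^ (2 * m) * K := by
  obtain ⟨C, hC⟩ := exists_legendreIntegral_le (m := m) (δ := m / 4) (by linarith) (by linarith)
  obtain ⟨D, hD⟩ := exists_legendreIntegral_le (m := m - 1) (δ := m / 4) (by linarith)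
    (by linarith)
  obtain ⟨K, hK⟩ := (isCompact_Icc (a := (0 : ℝ)) (b := 1)).prod
    ((isCompact_Icc (a := (0 : ℝ)) (b := C)).prod (isCompact_Icc (a := (0 : ℝ)) (b := D)))
    |>.exists_bound_of_continuousOn (f := fun x : ℝ × ℝ × ℝ => certificateForm m x.1 x.2.1 x.2.2)
      (by unfold certificateForm; fun_prop)
  refine ⟨K, fun t ht => ?_⟩
  have h1 := ht.1
  have h2 := sub_pos.2 ht.2
  have hp : 0 < t ^ (m / 4) := by positivity
  have hmem : ∀ {k E}, (legendreIntegral k t ≤ E * t ^ (-(m / 4))) →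
      t ^ (m / 4) * legendreIntegral k t ∈ Icc 0 E := fun {k E} h =>
    ⟨mul_nonneg hp.le (legendreIntegral_nonneg h1), by
      rwa [Real.rpow_neg h1.le, ← div_eq_mul_inv, le_div_iff₀ hp, mul_comm] at h⟩
  have hb := hK (t, t ^ (m / 4) * legendreIntegral m t, t ^ (m / 4) * legendreIntegral (m - 1) t)
    ⟨Ioo_subset_Icc_self ht, hmem (hC t h1), hmem (hD t h1)⟩
  have hpow : t ^ m = t ^ (m / 2) * (t ^ (m / 4)) ^ 2 := by
    rw [pow_two, ← Real.rpow_add h1, ← Real.rpow_add h1]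
    ring_nf
  have : certificate m t = t ^ (m / 2) * (1 - t) ^ (2 * m) * certificateForm m t
      (t ^ (m / 4) * legendreIntegral m t) (t ^ (m / 4) * legendreIntegral (m - 1) t) := by
    unfold certificate certificateForm
    rw [hpow]
    ring
  rw [this, abs_mul, abs_of_nonneg (by positivity)]
  gcongr
  exact hb

lemma integral_squareIntegrand_recurrence {m : ℝ} (hm : 0 < m) :
    (m + 1) ^ 3 * (∫ t in Ioo (0 : ℝ) 1, squareIntegrand (m + 1) t) -
      (2 * m + 1) * (17 * m ^ 2 + 17 * m + 5) * (∫ t in Ioo (0 : ℝ) 1, squareIntegrand m t) +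
      m ^ 3 * (∫ t in Ioo (0 : ℝ) 1, squareIntegrand (m - 1) t) = 0 := by
  have i1 := (integrableOn_squareIntegrand (by linarith : -1 < m + 1)).const_mul ((m + 1) ^ 3)
  have i2 := (integrableOn_squareIntegrand (by linarith : -1 < m)).const_mul
    ((2 * m + 1) * (17 * m ^ 2 + 17 * m + 5))
  have i3 := (integrableOn_squareIntegrand (by linarith : -1 < m - 1)).const_mul (m ^ 3)
  have i12 : IntegrableOn (fun t => (m + 1) ^ 3 * squareIntegrand (m + 1) t -
      (2 * m + 1) * (17 * m ^ 2 + 17 * m + 5) * squareIntegrand m t) (Ioo 0 1) := i1.sub i2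
  have i123 : IntegrableOn (fun t => (m + 1) ^ 3 * squareIntegrand (m + 1) t -
      (2 * m + 1) * (17 * m ^ 2 + 17 * m + 5) * squareIntegrand m t +
      m ^ 3 * squareIntegrand (m - 1) t) (Ioo 0 1) := i12.add i3
  obtain ⟨K, hK⟩ := exists_abs_certificate_le hm
  have hcont : Continuous fun t : ℝ => t ^ (m / 2) * (1 - t) ^ (2 * m) * K :=
    ((Real.continuous_rpow_const (by positivity)).mul
      ((Real.continuous_rpow_const (by positivity)).comp (by fun_prop))).mul_const K
  have hlim : ∀ (a : ℝ) (l : Filter ℝ), l ≤ 𝓝 a → Ioo 0 1 ∈ l →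
      a ^ (m / 2) * (1 - a) ^ (2 * m) = 0 → Tendsto (certificate m) l (𝓝 0) := fun a l hl hmem ha => by
    refine squeeze_zero_norm' (mem_of_superset hmem hK) ?_
    have := (hcont.tendsto a).mono_left hl
    rwa [ha, zero_mul] at this
  have := intervalIntegral.integral_eq_sub_of_hasDerivAt_of_tendsto zero_lt_one
    (fun t ht => hasDerivAt_certificate hm ht)
    ((intervalIntegrable_iff_integrableOn_Ioo_of_le zero_le_one).2 i123)
    (hlim 0 _ nhdsWithin_le_nhds (Ioo_mem_nhdsGT zero_lt_one)
      (by simp [Real.zero_rpow (by positivity : m / 2 ≠ 0)]))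
    (hlim 1 _ nhdsWithin_le_nhds (Ioo_mem_nhdsLT zero_lt_one)
      (by simp [Real.zero_rpow (by positivity : 2 * m ≠ 0)]))
  rwa [intervalIntegral.integral_of_le zero_le_one, integral_Ioc_eq_integral_Ioo,
    integral_add i12 i3, integral_sub i1 i2, integral_const_mul, integral_const_mul,
    integral_const_mul, sub_zero] at this

lemma measurable_ofReal_eulerIntegrand (p q r t : ℝ) :
    Measurable fun z => ENNReal.ofReal (eulerIntegrand p q r t z) :=
  ((measurable_eulerIntegrand p q r).comp measurable_prodMk_left).ennreal_ofReal

lemma lintegral_eulerIntegrand {m t : ℝ} (hm : -1 < m) (ht : 0 < t) :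
    ∫⁻ z in Ioo (0 : ℝ) 1, ENNReal.ofReal (eulerIntegrand m m (m + 1) t z) =
      ENNReal.ofReal (legendreIntegral m t) :=
  (ofReal_integral_eq_lintegral_ofReal (integrableOn_eulerIntegrand hm hm (by linarith) ht)
    ((ae_restrict_mem measurableSet_Ioo).mono fun _ hz => eulerIntegrand_nonneg ht hz)).symm

lemma lintegral_Ioo_zero_eq {x : ℝ} (hx : 0 < x) (g : ℝ → ENNReal) :
    ∫⁻ t in Ioo 0 x, g t = ∫⁻ y in Ioo (0 : ℝ) 1, ENNReal.ofReal x * g (x * y) := by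
  have himg : (fun y => x * y) '' Ioo 0 1 = Ioo 0 x := by
    rw [image_mul_left_Ioo hx, mul_zero, mul_one]
  rw [← himg, lintegral_image_eq_lintegral_abs_deriv_mul (f' := fun _ => x) measurableSet_Ioo
    (fun y _ => by simpa using ((hasDerivAt_id y).const_mul x).hasDerivWithinAt)
    (mul_right_injective₀ hx.ne').injOn, abs_of_pos hx]

lemma lintegral_Ioo_one_eq {t : ℝ} (ht : t < 1) (g : ℝ → ENNReal) :
    ∫⁻ x in Ioo t 1, g x =
      ∫⁻ w in Ioo (0 : ℝ) 1, ENNReal.ofReal (1 - t) * g (1 - (1 - t) * w) := by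
  have ht' := sub_pos.2 ht
  have himg : (fun w => 1 - (1 - t) * w) '' Ioo 0 1 = Ioo t 1 := by
    rw [← image_image (fun s => 1 - s) (fun w => (1 - t) * w), image_mul_left_Ioo ht',
      image_const_sub_Ioo]
    simp
  rw [← himg, lintegral_image_eq_lintegral_abs_deriv_mul (f' := fun _ => -(1 - t))
    measurableSet_Ioo
    (fun y _ => by simpa using (((hasDerivAt_id y).const_mul (1 - t)).const_sub 1).hasDerivWithinAt)
    (fun a _ b _ h => mul_left_cancel₀ ht'.ne' (sub_right_injective h)), abs_neg, abs_of_pos ht']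

/-- The Beukers integrand after integrating out `z` and substituting `t = x * y`. -/
lemma lintegral_beukers_eq {m : ℝ} {W : ℝ → ENNReal} (hW : Measurable W) :
    ∫⁻ x in Ioo (0 : ℝ) 1, ∫⁻ y in Ioo (0 : ℝ) 1,
        ENNReal.ofReal (x ^ m * (1 - x) ^ m * y ^ m * (1 - y) ^ m) * W (x * y) =
      ∫⁻ t in Ioo (0 : ℝ) 1, ENNReal.ofReal (t ^ m * (1 - t) ^ (2 * m + 1)) *
        (∫⁻ z in Ioo (0 : ℝ) 1, ENNReal.ofReal (eulerIntegrand m m (m + 1) t z)) * W t := by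
  set k : ℝ → ℝ → ENNReal := fun x t =>
    ENNReal.ofReal (t ^ m * (1 - x) ^ m * (x - t) ^ m / x ^ (m + 1)) * W t with hk
  have hkm : Measurable fun q : ℝ × ℝ => k q.1 q.2 := by fun_prop
  have hsub : ∀ x ∈ Ioo (0 : ℝ) 1, ∫⁻ y in Ioo (0 : ℝ) 1,
      ENNReal.ofReal (x ^ m * (1 - x) ^ m * y ^ m * (1 - y) ^ m) * W (x * y) =
      ∫⁻ t in Ioo (0 : ℝ) 1, {q : ℝ × ℝ | q.2 < q.1}.indicator (fun q => k q.1 q.2) (x, t) := by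
    intro x hx
    have : Iio x ∩ Ioo 0 1 = Ioo 0 x := by
      ext t
      simp only [mem_inter_iff, mem_Iio, mem_Ioo]
      exact ⟨fun h => ⟨h.2.1, h.1⟩, fun h => ⟨h.2, h.1, h.2.trans hx.2⟩⟩
    rw [show (fun t => {q : ℝ × ℝ | q.2 < q.1}.indicator (fun q => k q.1 q.2) (x, t)) =
      (Iio x).indicator (k x) from rfl, setLIntegral_indicator measurableSet_Iio, this,
      lintegral_Ioo_zero_eq hx.1]
    refine setLIntegral_congr_fun measurableSet_Ioo fun y hy => ?_
    have h1 := hx.1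
    have h2 := hy.1
    have h3 := sub_pos.2 hy.2
    simp only [hk]
    rw [← mul_assoc, ← ENNReal.ofReal_mul h1.le]
    congr 2
    rw [show x - x * y = x * (1 - y) by ring, Real.mul_rpow h1.le h2.le,
      Real.mul_rpow h1.le h3.le, Real.rpow_add_one h1.ne']
    field_simp
  rw [setLIntegral_congr_fun measurableSet_Ioo hsub, lintegral_lintegral_swap
    (f := fun x t => {q : ℝ × ℝ | q.2 < q.1}.indicator (fun q => k q.1 q.2) (x, t))
    (hkm.indicator (measurableSet_lt measurable_snd measurable_fst)).aemeasurable]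
  refine setLIntegral_congr_fun measurableSet_Ioo fun t ht => ?_
  have hset : Ioi t ∩ Ioo 0 1 = Ioo t 1 := by
    ext x
    simp only [mem_inter_iff, mem_Ioi, mem_Ioo]
    exact ⟨fun h => ⟨h.1, h.2.2⟩, fun h => ⟨h.1, ht.1.trans h.1, h.2⟩⟩
  have ht1 := ht.1
  have ht2 := sub_pos.2 ht.2
  have hm := measurable_ofReal_eulerIntegrand m m (m + 1) t
  calc ∫⁻ x in Ioo (0 : ℝ) 1, {q : ℝ × ℝ | q.2 < q.1}.indicator (fun q => k q.1 q.2) (x, t)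
      = ∫⁻ x in Ioo (0 : ℝ) 1, (Ioi t).indicator (fun x => k x t) x := rfl
    _ = ∫⁻ w in Ioo (0 : ℝ) 1, ENNReal.ofReal (1 - t) * k (1 - (1 - t) * w) t := by
      rw [setLIntegral_indicator measurableSet_Ioi, hset, lintegral_Ioo_one_eq ht.2]
    _ = ∫⁻ w in Ioo (0 : ℝ) 1, ENNReal.ofReal (t ^ m * (1 - t) ^ (2 * m + 1)) *
          ENNReal.ofReal (eulerIntegrand m m (m + 1) t w) * W t := by
      refine setLIntegral_congr_fun measurableSet_Ioo fun w hw => ?_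
      have h1 := hw.1
      have h2 := sub_pos.2 hw.2
      simp only [hk]
      rw [← mul_assoc, ← ENNReal.ofReal_mul ht2.le, ← ENNReal.ofReal_mul (by positivity)]
      congr 2
      unfold eulerIntegrand
      rw [show 1 - (1 - (1 - t) * w) = (1 - t) * w by ring,
        show 1 - (1 - t) * w - t = (1 - t) * (1 - w) by ring, Real.mul_rpow ht2.le h1.le,
        Real.mul_rpow ht2.le h2.le, Real.rpow_add_one ht2.ne', two_mul, Real.rpow_add ht2]
      ring
    _ = _ := by
      rw [lintegral_mul_const _ (hm.const_mul _), lintegral_const_mul _ hm]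

lemma beukersIntegral_eq_integral_squareIntegrand {m : ℝ} (hm : -1 < m) :
    (∫ p in Ioo (0 : ℝ) 1 ×ˢ Ioo (0 : ℝ) 1 ×ˢ Ioo (0 : ℝ) 1,
      p.1 ^ m * (1 - p.1) ^ m * p.2.1 ^ m * (1 - p.2.1) ^ m * p.2.2 ^ m * (1 - p.2.2) ^ m /
        (1 - (1 - p.1 * p.2.1) * p.2.2) ^ (m + 1)) =
      ∫ t in Ioo (0 : ℝ) 1, squareIntegrand m t := by
  set f : ℝ × ℝ × ℝ → ℝ := fun p =>
    p.1 ^ m * (1 - p.1) ^ m * p.2.1 ^ m * (1 - p.2.1) ^ m * p.2.2 ^ m * (1 - p.2.2) ^ m /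
      (1 - (1 - p.1 * p.2.1) * p.2.2) ^ (m + 1) with hf
  set W : ℝ → ENNReal := fun t =>
    ∫⁻ z in Ioo (0 : ℝ) 1, ENNReal.ofReal (eulerIntegrand m m (m + 1) t z) with hW
  have hWm : Measurable W :=
    (measurable_eulerIntegrand m m (m + 1)).ennreal_ofReal.lintegral_prod_right'
  have hfm : Measurable f := by fun_prop
  have hfactor : ∀ x y z, f (x, y, z) =
      x ^ m * (1 - x) ^ m * y ^ m * (1 - y) ^ m * eulerIntegrand m m (m + 1) (x * y) z := by
    intro x y z
    simp only [hf, eulerIntegrand]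
    ring
  have hinner : ∀ x ∈ Ioo (0 : ℝ) 1, ∀ y ∈ Ioo (0 : ℝ) 1,
      ∫⁻ z in Ioo (0 : ℝ) 1, ENNReal.ofReal (f (x, y, z)) =
        ENNReal.ofReal (x ^ m * (1 - x) ^ m * y ^ m * (1 - y) ^ m) * W (x * y) := by
    intro x hx y hy
    have h1 := hx.1
    have h2 := sub_pos.2 hx.2
    have h3 := hy.1
    have h4 := sub_pos.2 hy.2
    simp only [hfactor, hW]
    rw [← lintegral_const_mul _ (measurable_ofReal_eulerIntegrand _ _ _ _)]
    exact lintegral_congr fun z => ENNReal.ofReal_mul (by positivity)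
  have hf0 : 0 ≤ᵐ[volume.restrict (Ioo (0 : ℝ) 1 ×ˢ Ioo (0 : ℝ) 1 ×ˢ Ioo (0 : ℝ) 1)] f := by
    refine (ae_restrict_mem
      (measurableSet_Ioo.prod (measurableSet_Ioo.prod measurableSet_Ioo))).mono ?_
    rintro ⟨x, y, z⟩ ⟨hx, hy, hz⟩
    have h1 := hx.1
    have h2 := sub_pos.2 hx.2
    have h3 := hy.1
    have h4 := sub_pos.2 hy.2
    have h5 := eulerIntegrand_nonneg (p := m) (q := m) (r := m + 1) (mul_pos h1 h3) hz
    simp only [Pi.zero_apply, hfactor] at h1 h3 ⊢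
    positivity
  rw [integral_eq_lintegral_of_nonneg_ae hf0 hfm.aestronglyMeasurable,
    integral_eq_lintegral_of_nonneg_ae
      ((ae_restrict_mem measurableSet_Ioo).mono fun _ => squareIntegrand_nonneg)
      (aestronglyMeasurable_squareIntegrand hm)]
  congr 1
  rw [Measure.volume_eq_prod, ← Measure.prod_restrict, Measure.volume_eq_prod,
    ← Measure.prod_restrict, lintegral_prod _ hfm.ennreal_ofReal.aemeasurable]
  calc _ = ∫⁻ x in Ioo (0 : ℝ) 1, ∫⁻ y in Ioo (0 : ℝ) 1,
        ENNReal.ofReal (x ^ m * (1 - x) ^ m * y ^ m * (1 - y) ^ m) * W (x * y) := by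
        refine setLIntegral_congr_fun measurableSet_Ioo fun x hx => ?_
        have hfx : Measurable fun q => ENNReal.ofReal (f (x, q)) :=
          (hfm.comp measurable_prodMk_left).ennreal_ofReal
        rw [lintegral_prod _ hfx.aemeasurable]
        exact setLIntegral_congr_fun measurableSet_Ioo fun y hy => hinner x hx y hy
    _ = ∫⁻ t in Ioo (0 : ℝ) 1, ENNReal.ofReal (t ^ m * (1 - t) ^ (2 * m + 1)) * W t * W t :=
        lintegral_beukers_eq hWm
    _ = _ := by
        refine setLIntegral_congr_fun measurableSet_Ioo fun t ht => ?_
        have h1 := ht.1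
        have h2 := sub_pos.2 ht.2
        have h3 := legendreIntegral_nonneg (m := m) h1
        simp only [hW, squareIntegrand]
        rw [lintegral_eulerIntegrand hm h1, ← ENNReal.ofReal_mul (by positivity),
          ← ENNReal.ofReal_mul (by positivity)]
        ring_nf

lemma I₃_eq_integral_squareIntegrand (n : ℕ) :
    I₃ n = ∫ t in Ioo (0 : ℝ) 1, squareIntegrand ((n : ℝ) - 1 / 2) t := by
  have hn : (0 : ℝ) ≤ n := n.cast_nonneg
  rw [← beukersIntegral_eq_integral_squareIntegrand (by linarith), I₃,
    show (n : ℝ) - 1 / 2 + 1 = n + 1 / 2 by ring]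

/-- For every `n ≥ 1`, `(2n+1)³·I₃(n+1) = 4n(68n²+3)·I₃(n) - (2n-1)³·I₃(n-1)`. -/
theorem I₃_recurrence (n : ℕ) (hn : 1 ≤ n) :
    (2 * (n : ℝ) + 1) ^ 3 * I₃ (n + 1)
      = 4 * (n : ℝ) * (68 * (n : ℝ) ^ 2 + 3) * I₃ n
          - (2 * (n : ℝ) - 1) ^ 3 * I₃ (n - 1) := by
  have hn' : (1 : ℝ) ≤ n := by exact_mod_cast hn
  have h := integral_squareIntegrand_recurrence (m := (n : ℝ) - 1 / 2) (by linarith)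
  simp only [I₃_eq_integral_squareIntegrand]
  rw [show ((n + 1 : ℕ) : ℝ) - 1 / 2 = n - 1 / 2 + 1 by push_cast; ring,
    show ((n - 1 : ℕ) : ℝ) - 1 / 2 = n - 1 / 2 - 1 by push_cast [hn]; ring]
  linear_combination 8 * h
end

section
/- The triple integral ∭_{[0,1]³} dx dy dz/√(x(1-x)y(1-y)z(1-z)(1-xyz)) converges and equals π³·Σ_{n≥0} ((1/2)_n/n!)⁴. -/
open MeasureTheory Real

/-- The rising Pochhammer symbol `(a)_n = a(a+1)⋯(a+n-1)`. -/
def poch (a : ℝ) (n : ℕ) : ℝ := ∏ i ∈ Finset.range n, (a + i)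

theorem poch_succ (a : ℝ) (n : ℕ) : poch a (n + 1) = poch a n * (a + n) := by
  simp [poch, Finset.prod_range_succ]

theorem poch_div_factorial_succ (a : ℝ) (n : ℕ) :
    poch a (n + 1) / ((n + 1).factorial : ℝ) =
      poch a n / (n.factorial : ℝ) * ((a + n) / (n + 1)) := by
  rw [poch_succ, Nat.factorial_succ, Nat.cast_mul, Nat.cast_succ]
  field_simp

theorem poch_pos {a : ℝ} (ha : 0 < a) (n : ℕ) : 0 < poch a n :=
  Finset.prod_pos fun _ _ => by positivity

theorem poch_half_div_factorial_sq_mul_le_one (n : ℕ) :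
    (poch (1 / 2) n / (n.factorial : ℝ)) ^ 2 * (2 * n + 1) ≤ 1 := by
  induction n with
  | zero => simp [poch]
  | succ n ih =>
    refine le_trans ?_ ih
    rw [poch_div_factorial_succ, mul_pow, mul_assoc]
    refine mul_le_mul_of_nonneg_left ?_ (sq_nonneg _)
    rw [div_pow, div_mul_eq_mul_div, div_le_iff₀ (by positivity)]
    push_cast
    have : (0 : ℝ) ≤ n := n.cast_nonneg
    nlinarith

theorem summable_poch_half_div_factorial_pow_four :
    Summable fun n : ℕ => (poch (1 / 2) n / (n.factorial : ℝ)) ^ 4 := by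
  have h : Summable fun n : ℕ => 1 / ((n + 1 : ℕ) : ℝ) ^ 2 :=
    (summable_nat_add_iff 1).2 (Real.summable_one_div_nat_pow.2 one_lt_two)
  refine h.of_nonneg_of_le (fun n => by positivity) fun n => ?_
  have h1 : (poch (1 / 2) n / (n.factorial : ℝ)) ^ 2 ≤ 1 / ((n + 1 : ℕ) : ℝ) := by
    rw [le_div_iff₀ (by positivity)]
    refine le_trans (mul_le_mul_of_nonneg_left ?_ (sq_nonneg _))
      (poch_half_div_factorial_sq_mul_le_one n)
    push_cast
    linarith [(n.cast_nonneg : (0 : ℝ) ≤ n)]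
  calc (poch (1 / 2) n / (n.factorial : ℝ)) ^ 4
      = ((poch (1 / 2) n / (n.factorial : ℝ)) ^ 2) ^ 2 := by ring
    _ ≤ (1 / ((n + 1 : ℕ) : ℝ)) ^ 2 := by gcongr
    _ = 1 / ((n + 1 : ℕ) : ℝ) ^ 2 := by rw [div_pow, one_pow]

theorem choose_add_sub_one_eq_poch_div_factorial (a : ℝ) (n : ℕ) :
    Ring.choose (a + n - 1) n = poch a n / (n.factorial : ℝ) := by
  rw [← Ring.multichoose_eq, eq_div_iff (by positivity), mul_comm, ← nsmul_eq_mul,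
    Ring.factorial_nsmul_multichoose_eq_ascPochhammer, Polynomial.ascPochhammer_smeval_eq_eval]
  induction n with
  | zero => simp [poch]
  | succ n ih => rw [ascPochhammer_succ_eval, ih, poch_succ]

theorem hasSum_one_div_sqrt_one_sub {t : ℝ} (ht : |t| < 1) :
    HasSum (fun n : ℕ => poch (1 / 2) n / (n.factorial : ℝ) * t ^ n) (1 / √(1 - t)) := by
  have h := (Real.one_div_one_sub_rpow_hasFPowerSeriesOnBall_zero (1 / 2)).hasSum (y := t)
    (by simpa [enorm_eq_nnnorm, ← NNReal.coe_lt_coe] using ht)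
  simpa [FormalMultilinearSeries.ofScalars, choose_add_sub_one_eq_poch_div_factorial,
    ← Real.sqrt_eq_rpow, -one_div] using h

theorem hasDerivAt_arcsin_two_mul_sub_one {x : ℝ} (hx : x ∈ Set.Ioo (0 : ℝ) 1) :
    HasDerivAt (fun x => arcsin (2 * x - 1)) (1 / √(x * (1 - x))) x := by
  obtain ⟨h0, h1⟩ := hx
  have h := (Real.hasDerivAt_arcsin (x := 2 * x - 1) (by linarith) (by linarith)).comp x
    (((hasDerivAt_id x).const_mul 2).sub_const 1)
  convert! h using 1
  rw [show 1 - (2 * x - 1) ^ 2 = 2 ^ 2 * (x * (1 - x)) by ring,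
    Real.sqrt_mul (by norm_num : (0 : ℝ) ≤ 2 ^ 2), Real.sqrt_sq zero_le_two]
  field_simp

theorem continuousOn_arcsin_two_mul_sub_one :
    ContinuousOn (fun x : ℝ => arcsin (2 * x - 1)) (Set.Icc 0 1) := by
  fun_prop

theorem integrableOn_one_div_sqrt_mul_one_sub :
    IntegrableOn (fun x : ℝ => 1 / √(x * (1 - x))) (Set.Ioc 0 1) :=
  intervalIntegral.integrableOn_deriv_of_nonneg continuousOn_arcsin_two_mul_sub_one
    (fun _ hx => hasDerivAt_arcsin_two_mul_sub_one hx) fun _ _ => by positivity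

theorem integrableOn_pow_div_sqrt_mul_one_sub (n : ℕ) :
    IntegrableOn (fun x : ℝ => x ^ n / √(x * (1 - x))) (Set.Ioc 0 1) := by
  refine integrableOn_one_div_sqrt_mul_one_sub.mono'
    (by fun_prop : Measurable _).aestronglyMeasurable
    ((ae_restrict_iff' measurableSet_Ioc).2 (.of_forall fun x hx => ?_))
  have hx0 := hx.1.le
  rw [Real.norm_of_nonneg (by positivity)]
  gcongr
  exact pow_le_one₀ hx0 hx.2

theorem hasDerivAt_pow_mul_sqrt_mul_one_sub (n : ℕ) {x : ℝ} (hx : x ∈ Set.Ioo (0 : ℝ) 1) :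
    HasDerivAt (fun x => x ^ n * √(x * (1 - x)))
      ((n + 1 / 2) * (x ^ n / √(x * (1 - x))) - (n + 1) * (x ^ (n + 1) / √(x * (1 - x)))) x := by
  have hpos : 0 < x * (1 - x) := mul_pos hx.1 (by linarith [hx.2])
  have hq : HasDerivAt (fun x : ℝ => x * (1 - x)) (1 - 2 * x) x := by
    convert! (hasDerivAt_id x).mul ((hasDerivAt_id x).const_sub 1) using 1
    simp only [id]
    ring
  convert! (hasDerivAt_pow n x).mul (hq.sqrt hpos.ne') using 1
  have hs : √(x * (1 - x)) ^ 2 = x * (1 - x) := Real.sq_sqrt hpos.le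
  have hs0 : √(x * (1 - x)) ≠ 0 := (Real.sqrt_pos.2 hpos).ne'
  cases n with
  | zero =>
    field_simp
    simp
  | succ n =>
    field_simp
    rw [hs]
    push_cast
    ring

theorem integral_pow_div_sqrt_mul_one_sub (n : ℕ) :
    ∫ x in Set.Ioo (0 : ℝ) 1, x ^ n / √(x * (1 - x)) =
      π * (poch (1 / 2) n / (n.factorial : ℝ)) := by
  rw [← integral_Ioc_eq_integral_Ioo, ← intervalIntegral.integral_of_le zero_le_one]
  have hint (n : ℕ) : IntervalIntegrable (fun x : ℝ => x ^ n / √(x * (1 - x))) volume 0 1 :=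
    (intervalIntegrable_iff_integrableOn_Ioc_of_le zero_le_one).2
      (integrableOn_pow_div_sqrt_mul_one_sub n)
  induction n with
  | zero =>
    have h := intervalIntegral.integral_eq_sub_of_hasDerivAt_of_le zero_le_one
      continuousOn_arcsin_two_mul_sub_one (fun _ hx => hasDerivAt_arcsin_two_mul_sub_one hx)
      (by simpa using hint 0)
    simp only [pow_zero, h]
    norm_num [poch]
  | succ n ih =>
    have h := intervalIntegral.integral_eq_sub_of_hasDerivAt_of_le zero_le_one
      (f := fun x : ℝ => x ^ n * √(x * (1 - x))) (by fun_prop)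
      (fun _ hx => hasDerivAt_pow_mul_sqrt_mul_one_sub n hx)
      (((hint n).const_mul _).sub ((hint (n + 1)).const_mul _))
    rw [intervalIntegral.integral_sub ((hint n).const_mul _) ((hint (n + 1)).const_mul _),
      intervalIntegral.integral_const_mul, intervalIntegral.integral_const_mul, ih] at h
    rw [poch_div_factorial_succ]
    simp only [sub_self, mul_zero, zero_mul, Real.sqrt_zero] at h
    field_simp at h ⊢
    linarith

theorem hasSum_one_div_sqrt_triple {x y z : ℝ} (hx : x ∈ Set.Ioo (0 : ℝ) 1)
    (hy : y ∈ Set.Ioo (0 : ℝ) 1) (hz : z ∈ Set.Ioo (0 : ℝ) 1) :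
    HasSum (fun n : ℕ => poch (1 / 2) n / (n.factorial : ℝ) *
      (x ^ n / √(x * (1 - x)) * (y ^ n / √(y * (1 - y)) * (z ^ n / √(z * (1 - z))))))
      (1 / √(x * (1 - x) * y * (1 - y) * z * (1 - z) * (1 - x * y * z))) := by
  have hx' : 0 < x * (1 - x) := mul_pos hx.1 (by linarith [hx.2])
  have hy' : 0 < y * (1 - y) := mul_pos hy.1 (by linarith [hy.2])
  have hxy : x * y < 1 := mul_lt_one_of_nonneg_of_lt_one_left hx.1.le hx.2 hy.2.le
  have hxy0 : 0 < x * y := mul_pos hx.1 hy.1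
  have hz' : 0 < z * (1 - z) := mul_pos hz.1 (by linarith [hz.2])
  have ht : |x * y * z| < 1 := by
    rw [abs_of_pos (mul_pos hxy0 hz.1)]
    exact mul_lt_one_of_nonneg_of_lt_one_left hxy0.le hxy hz.2.le
  convert! (hasSum_one_div_sqrt_one_sub ht).mul_left
    (1 / (√(x * (1 - x)) * √(y * (1 - y)) * √(z * (1 - z)))) using 1
  · ext n
    rw [mul_pow, mul_pow]
    field_simp
  · rw [show x * (1 - x) * y * (1 - y) * z * (1 - z) * (1 - x * y * z) =
        x * (1 - x) * (y * (1 - y)) * (z * (1 - z)) * (1 - x * y * z) by ring,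
      Real.sqrt_mul (by positivity), Real.sqrt_mul (by positivity), Real.sqrt_mul hx'.le]
    field_simp

/-- `∭_{[0,1]³} dx dy dz/√(x(1-x)y(1-y)z(1-z)(1-xyz))` converges and equals
`π³·₄F₃(1/2,1/2,1/2,1/2;1,1,1;1)`. -/
theorem triple_integral_4F3 :
    IntegrableOn
      (fun p : ℝ × ℝ × ℝ =>
        1 / Real.sqrt (p.1 * (1 - p.1) * p.2.1 * (1 - p.2.1) * p.2.2 * (1 - p.2.2) *
          (1 - p.1 * p.2.1 * p.2.2)))
      (Set.Ioo (0 : ℝ) 1 ×ˢ Set.Ioo (0 : ℝ) 1 ×ˢ Set.Ioo (0 : ℝ) 1) ∧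
    (∫ p in Set.Ioo (0 : ℝ) 1 ×ˢ Set.Ioo (0 : ℝ) 1 ×ˢ Set.Ioo (0 : ℝ) 1,
        1 / Real.sqrt (p.1 * (1 - p.1) * p.2.1 * (1 - p.2.1) * p.2.2 * (1 - p.2.2) *
          (1 - p.1 * p.2.1 * p.2.2)))
      = π ^ 3 * ∑' n : ℕ, (poch (1 / 2) n / (n.factorial : ℝ)) ^ 4 := by
  set I := Set.Ioo (0 : ℝ) 1
  set f : ℕ → ℝ → ℝ := fun n x => x ^ n / √(x * (1 - x))
  set c : ℕ → ℝ := fun n => poch (1 / 2) n / (n.factorial : ℝ)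
  set F : ℕ → ℝ × ℝ × ℝ → ℝ := fun n p => c n * (f n p.1 * (f n p.2.1 * f n p.2.2)) with hF
  have hc_pos (n : ℕ) : 0 < c n := div_pos (poch_pos (by norm_num) n) (by positivity)
  have hI : MeasurableSet (I ×ˢ I ×ˢ I) :=
    measurableSet_Ioo.prod (measurableSet_Ioo.prod measurableSet_Ioo)
  have hf_int (n : ℕ) : Integrable (f n) (volume.restrict I) :=
    (integrableOn_pow_div_sqrt_mul_one_sub n).mono_set Set.Ioo_subset_Ioc_self
  have hF_int (n : ℕ) : IntegrableOn (F n) (I ×ˢ I ×ˢ I) := by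
    rw [IntegrableOn, Measure.volume_eq_prod, ← Measure.prod_restrict, Measure.volume_eq_prod,
      ← Measure.prod_restrict]
    exact ((hf_int n).mul_prod ((hf_int n).mul_prod (hf_int n))).const_mul _
  have hF_integral (n : ℕ) : ∫ p in I ×ˢ I ×ˢ I, F n p = π ^ 3 * c n ^ 4 := by
    simp only [hF]
    rw [integral_const_mul, Measure.volume_eq_prod, setIntegral_prod_mul (f n)
      (fun q : ℝ × ℝ => f n q.1 * f n q.2), Measure.volume_eq_prod, setIntegral_prod_mul (f n) (f n),
      integral_pow_div_sqrt_mul_one_sub]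
    ring
  have hF_norm (n : ℕ) : ∫ p in I ×ˢ I ×ˢ I, ‖F n p‖ = π ^ 3 * c n ^ 4 := by
    rw [← hF_integral]
    refine setIntegral_congr_fun hI fun p hp => Real.norm_of_nonneg ?_
    have h1 := hp.1.1
    have h2 := hp.2.1.1
    have h3 := hp.2.2.1
    have := hc_pos n
    positivity
  have hsum := summable_poch_half_div_factorial_pow_four
  have key := hasSum_integral_of_summable_integral_norm hF_int
    (by simpa only [hF_norm] using hsum.mul_left (π ^ 3))
  simp only [hF_integral] at key
  have hval := key.unique (hsum.hasSum.mul_left (π ^ 3))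
  rw [setIntegral_congr_fun hI fun p hp =>
    (hasSum_one_div_sqrt_triple hp.1 hp.2.1 hp.2.2).tsum_eq] at hval
  refine ⟨Integrable.of_integral_ne_zero ?_, hval⟩
  rw [hval]
  have : 0 < ∑' n, c n ^ 4 := hsum.tsum_pos (fun n => by positivity) 0 (pow_pos (hc_pos 0) 4)
  positivity
end

section
/- Let p, q : ℕ → ℝ both satisfy the recurrence u(n) = (40n² + 2)·u(n-1) - 9(2n-1)⁴·u(n-2) for all n ≥ 2, with initial values p(0) = 36, p(1) = 36·33 + 324 = 1512, q(0) = 1, q(1) = 33. Then q(n) ≠ 0 for all n, the sequence p(n)/q(n) converges to L = 2^{-1/3}·(Γ(1/3)/Γ(2/3))⁶, and moreover L - p(n)/q(n) is asymptotically equivalent (as n → ∞) to 4L/3^{2n+2}. -/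
open Filter Real Asymptotics

namespace ShiftedChi3

open scoped Topology Nat
open Finset (range)

/-- The normalized central binomial coefficients `(1/2)ₙ / n! = binom(2n, n) / 4ⁿ`. -/
noncomputable def halfRatio (n : ℕ) : ℝ := ∏ i ∈ range n, (2 * (i : ℝ) + 1) / (2 * i + 2)

/-- The terms of `∑ₖ (1/2)ₖ³ / (k! (N + k)!²) 4⁻ᵏ`. -/
noncomputable def term (N k : ℕ) : ℝ :=
  halfRatio k ^ 3 * ((k ! : ℝ) / (N + k)!) ^ 2 / 4 ^ k

/-- The moments `∑ₖ kʲ · term N k`. -/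
noncomputable def moment (j N : ℕ) : ℝ := ∑' k : ℕ, (k : ℝ) ^ j * term N k

lemma halfRatio_succ (n : ℕ) :
    halfRatio (n + 1) = halfRatio n * ((2 * (n : ℝ) + 1) / (2 * n + 2)) :=
  Finset.prod_range_succ _ _

lemma halfRatio_pos (n : ℕ) : 0 < halfRatio n :=
  Finset.prod_pos fun _ _ => by positivity

lemma halfRatio_le_one (n : ℕ) : halfRatio n ≤ 1 :=
  Finset.prod_le_one (fun _ _ => by positivity) fun i _ => by
    rw [div_le_one (by positivity)]; linarith

lemma term_pos (N k : ℕ) : 0 < term N k := by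
  have := halfRatio_pos k
  unfold term
  positivity

lemma term_succ_right (N k : ℕ) :
    term N (k + 1) * (32 * ((k : ℝ) + 1) * (N + k + 1) ^ 2) = term N k * (2 * k + 1) ^ 3 := by
  unfold term
  rw [halfRatio_succ, ← Nat.add_assoc, Nat.factorial_succ (N + k), Nat.factorial_succ k, pow_succ]
  push_cast
  field_simp
  ring

lemma term_succ_left (N k : ℕ) : term (N + 1) k * ((N : ℝ) + k + 1) ^ 2 = term N k := by
  unfold term
  rw [Nat.add_right_comm, Nat.factorial_succ (N + k)]
  push_cast
  field_simp

lemma factorial_sq_mul_term_le (N k : ℕ) : (N ! : ℝ) ^ 2 * term N k ≤ (1 / 4) ^ k := by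
  have h1 : (N ! : ℝ) * ((k ! : ℝ) / (N + k)!) ≤ 1 := by
    rw [← mul_div_assoc, div_le_one (by positivity)]
    exact_mod_cast Nat.le_of_dvd (by positivity) (Nat.factorial_mul_factorial_dvd_factorial_add N k)
  have h2 := halfRatio_le_one k
  have h3 := halfRatio_pos k
  have : (N ! : ℝ) ^ 2 * term N k =
      halfRatio k ^ 3 * ((N ! : ℝ) * ((k ! : ℝ) / (N + k)!)) ^ 2 * (1 / 4) ^ k := by
    unfold term
    rw [one_div, inv_pow]
    ring
  rw [this]
  have h4 : halfRatio k ^ 3 ≤ 1 := pow_le_one₀ h3.le h2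
  have h5 : ((N ! : ℝ) * ((k ! : ℝ) / (N + k)!)) ^ 2 ≤ 1 := pow_le_one₀ (by positivity) h1
  exact mul_le_of_le_one_left (by positivity) (mul_le_one₀ h4 (by positivity) h5)

lemma factorial_mul_factorial_succ_le (N k : ℕ) : (k + 1)! * (N + 1)! ≤ (N + k + 1)! := by
  induction k with
  | zero => simp
  | succ k ih =>
    rw [Nat.factorial_succ (k + 1), ← Nat.add_assoc, Nat.factorial_succ (N + k + 1), mul_assoc]
    exact Nat.mul_le_mul (by omega) ih

lemma factorial_sq_mul_term_succ_le (N k : ℕ) :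
    (N ! : ℝ) ^ 2 * term N (k + 1) ≤ 1 / (N + 1) * (1 / 4) ^ k := by
  have h1 : (N ! : ℝ) * (((k + 1)! : ℝ) / (N + (k + 1))!) ≤ 1 / (N + 1) := by
    rw [← mul_div_assoc, div_le_div_iff₀ (by positivity) (by positivity)]
    have := factorial_mul_factorial_succ_le N k
    rw [Nat.factorial_succ N] at this
    have h : (((k + 1)! * ((N + 1) * N !) : ℕ) : ℝ) ≤ ((N + k + 1)! : ℕ) := by exact_mod_cast this
    push_cast at h
    rw [← Nat.add_assoc]
    linarith
  have h2 : halfRatio (k + 1) ^ 3 ≤ 1 :=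
    pow_le_one₀ (halfRatio_pos _).le (halfRatio_le_one _)
  have h3 : 1 / ((N : ℝ) + 1) ≤ 1 := by
    rw [div_le_one (by positivity)]; linarith [N.cast_nonneg (α := ℝ)]
  have h4 : (1 / 4 : ℝ) ^ (k + 1) ≤ (1 / 4) ^ k :=
    pow_le_pow_of_le_one (by norm_num) (by norm_num) k.le_succ
  have : (N ! : ℝ) ^ 2 * term N (k + 1) = halfRatio (k + 1) ^ 3 *
      ((N ! : ℝ) * (((k + 1)! : ℝ) / (N + (k + 1))!)) ^ 2 * (1 / 4) ^ (k + 1) := by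
    unfold term
    rw [one_div, inv_pow]
    ring
  rw [this]
  have h5 : ((N ! : ℝ) * (((k + 1)! : ℝ) / (N + (k + 1))!)) ^ 2 ≤ 1 / (N + 1) := by
    refine le_trans (pow_le_of_le_one (by positivity) (h1.trans h3) two_ne_zero) h1
  refine mul_le_mul ?_ h4 (by positivity) (by positivity)
  exact (mul_le_of_le_one_left (by positivity) h2).trans h5

lemma summable_pow_mul_term (j N : ℕ) : Summable fun k : ℕ => (k : ℝ) ^ j * term N k := by
  have hs : Summable fun k : ℕ => (k : ℝ) ^ j * (1 / 4 : ℝ) ^ k :=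
    summable_pow_mul_geometric_of_norm_lt_one j (by norm_num)
  refine Summable.of_nonneg_of_le (fun k => mul_nonneg (by positivity) (term_pos N k).le)
    (fun k => ?_) hs
  gcongr
  refine le_trans ?_ (factorial_sq_mul_term_le N k)
  refine le_mul_of_one_le_left (term_pos N k).le (one_le_pow₀ ?_)
  exact_mod_cast Nat.one_le_iff_ne_zero.mpr (Nat.factorial_ne_zero N)

lemma tsum_eq_neg_of_telescope {f H : ℕ → ℝ} (hf : Summable f) (hH : Tendsto H atTop (𝓝 0))
    (h : ∀ k, f k = H (k + 1) - H k) : ∑' k, f k = -H 0 := by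
  refine tendsto_nhds_unique hf.hasSum.tendsto_sum_nat ?_
  simp_rw [h, Finset.sum_range_sub]
  simpa using hH.sub_const (H 0)

lemma tendsto_pow_mul_term (j N : ℕ) : Tendsto (fun k : ℕ => (k : ℝ) ^ j * term N k) atTop (𝓝 0) :=
  (summable_pow_mul_term j N).tendsto_atTop_zero

/-- First order recurrence for `(4N + 1) ∑ term + 6 ∑ k term`. -/
lemma moment_recurrence (N : ℕ) :
    ((N : ℝ) + 1 / 2) ^ 2 * ((4 * N + 5) * moment 0 (N + 1) + 6 * moment 1 (N + 1)) =
      (4 * N + 1) * moment 0 N + 6 * moment 1 N := by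
  have s0 := summable_pow_mul_term 0 N
  have s1 := summable_pow_mul_term 1 N
  have t0 := summable_pow_mul_term 0 (N + 1)
  have t1 := summable_pow_mul_term 1 (N + 1)
  have key := tsum_eq_neg_of_telescope
    ((((t0.mul_left (4 * (N : ℝ) + 5)).add (t1.mul_left 6)).mul_left (((N : ℝ) + 1 / 2) ^ 2)).sub
      ((s0.mul_left (4 * (N : ℝ) + 1)).add (s1.mul_left 6)))
    (H := fun k => 8 * ((k : ℝ) ^ 1 * term N k))
    (by simpa using (tendsto_pow_mul_term 1 N).const_mul 8)
    (by
      intro k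
      have h1 := term_succ_right N k
      have h2 := term_succ_left N k
      have hk : (N : ℝ) + k + 1 ≠ 0 := by positivity
      have hk' : (k : ℝ) + 1 ≠ 0 := by positivity
      have e1 : term (N + 1) k = term N k / ((N : ℝ) + k + 1) ^ 2 := by
        rw [← h2]; field_simp
      have e2 : term N (k + 1) = term N k * (2 * k + 1) ^ 3 /
          (32 * ((k : ℝ) + 1) * (N + k + 1) ^ 2) := by
        rw [← h1]; field_simp
      rw [e1, e2]
      push_cast
      field_simp
      ring)
  rw [((((t0.mul_left _).add (t1.mul_left _)).mul_left _)).tsum_sub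
    ((s0.mul_left _).add (s1.mul_left _)), tsum_mul_left,
    (t0.mul_left _).tsum_add (t1.mul_left _), (s0.mul_left _).tsum_add (s1.mul_left _),
    tsum_mul_left, tsum_mul_left, tsum_mul_left, tsum_mul_left] at key
  simp only [moment]
  simp at key ⊢
  linarith

/-- Three-term recurrence for `∑ term`. -/
lemma moment_zero_recurrence (N : ℕ) :
    (2 * (N : ℝ) + 3) ^ 4 * moment 0 (N + 2) =
      4 * (40 * (N + 1) ^ 2 + 2) * moment 0 (N + 1) - 144 * moment 0 N := by
  have s0 := summable_pow_mul_term 0 N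
  have t0 := summable_pow_mul_term 0 (N + 1)
  have u0 := summable_pow_mul_term 0 (N + 1 + 1)
  have key := tsum_eq_neg_of_telescope
    (((u0.mul_left ((2 * (N : ℝ) + 3) ^ 4)).sub
      (t0.mul_left (4 * (40 * ((N : ℝ) + 1) ^ 2 + 2)))).add (s0.mul_left 144))
    (H := fun k => -192 * ((k : ℝ) ^ 2 * term (N + 1) k) +
      -(256 * N + 288) * ((k : ℝ) ^ 1 * term (N + 1) k))
    (by simpa using ((tendsto_pow_mul_term 2 (N + 1)).const_mul (-192)).add
          ((tendsto_pow_mul_term 1 (N + 1)).const_mul (-(256 * (N : ℝ) + 288))))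
    (by
      intro k
      have h1 := term_succ_right (N + 1) k
      have h2 := term_succ_left N k
      have h3 := term_succ_left (N + 1) k
      push_cast at h1 h3
      have e1 : term (N + 1 + 1) k = term (N + 1) k / ((N : ℝ) + k + 2) ^ 2 := by
        rw [eq_div_iff (by positivity), ← h3]; ring
      have e2 : term (N + 1) (k + 1) = term (N + 1) k * (2 * k + 1) ^ 3 /
          (32 * ((k : ℝ) + 1) * (N + k + 2) ^ 2) := by
        rw [eq_div_iff (by positivity), ← h1]; ring
      rw [e1, e2, ← h2]
      have hk : (N : ℝ) + k + 2 ≠ 0 := by positivity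
      push_cast
      field_simp
      ring)
  rw [((u0.mul_left _).sub (t0.mul_left _)).tsum_add (s0.mul_left _),
    (u0.mul_left _).tsum_sub (t0.mul_left _), tsum_mul_left, tsum_mul_left, tsum_mul_left] at key
  simp only [moment]
  simp at key ⊢
  linarith

/-- Contiguity relation between `∑ₖ aₖ³ 4⁻ᵏ / (k + 1)²` and `∑ₖ kʲ aₖ³ 4⁻ᵏ`. -/
lemma moment_zero_one : moment 0 1 = 8 * moment 0 0 - 144 * moment 2 0 := by
  have s0 := summable_pow_mul_term 0 0
  have s2 := summable_pow_mul_term 2 0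
  have t0 := summable_pow_mul_term 0 1
  have key := tsum_eq_neg_of_telescope
    (((s0.mul_left 8).sub (s2.mul_left 144)).sub t0)
    (H := fun k => 32 * ((k : ℝ) ^ 1 * term 0 k) + 192 * ((k : ℝ) ^ 2 * term 0 k))
    (by simpa using ((tendsto_pow_mul_term 1 0).const_mul 32).add
          ((tendsto_pow_mul_term 2 0).const_mul 192))
    (by
      intro k
      have h1 := term_succ_right 0 k
      have h2 := term_succ_left 0 k
      have hk' : (k : ℝ) + 1 ≠ 0 := by positivity
      have e1 : term (0 + 1) k = term 0 k / ((k : ℝ) + 1) ^ 2 := by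
        rw [← h2]; push_cast; field_simp; ring
      have e2 : term 0 (k + 1) = term 0 k * (2 * k + 1) ^ 3 /
          (32 * ((k : ℝ) + 1) ^ 3) := by
        rw [eq_div_iff (by positivity), ← h1]; push_cast; ring
      rw [zero_add] at e1
      rw [e1, e2]
      push_cast
      field_simp
      ring)
  rw [((s0.mul_left _).sub (s2.mul_left _)).tsum_sub t0,
    (s0.mul_left _).tsum_sub (s2.mul_left _), tsum_mul_left, tsum_mul_left] at key
  simp only [moment]
  simp at key ⊢
  linarith

lemma moment_zero_pos (N : ℕ) : 0 < moment 0 N :=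
  (summable_pow_mul_term 0 N).tsum_pos (fun k => by simpa using (term_pos N k).le) 0
    (by simpa using term_pos N 0)

lemma tendsto_factorial_sq_mul_moment_zero :
    Tendsto (fun N : ℕ => (N ! : ℝ) ^ 2 * moment 0 N) atTop (𝓝 1) := by
  have hg : HasSum (fun k : ℕ => (1 / 4 : ℝ) ^ k) (4 / 3) := by
    convert hasSum_geometric_of_lt_one (r := (1 / 4 : ℝ)) (by norm_num) (by norm_num) using 1
    norm_num
  have split (N : ℕ) : (N ! : ℝ) ^ 2 * moment 0 N =
      1 + ∑' k, (N ! : ℝ) ^ 2 * term N (k + 1) := by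
    have hs := summable_pow_mul_term 0 N
    rw [moment, hs.tsum_eq_zero_add, mul_add, tsum_mul_left]
    simp [term, halfRatio]
    field_simp
  have hs (N : ℕ) : Summable fun k => (N ! : ℝ) ^ 2 * term N (k + 1) := by
    simpa using ((summable_nat_add_iff 1).mpr (summable_pow_mul_term 0 N)).mul_left ((N ! : ℝ) ^ 2)
  have hlim : Tendsto (fun N : ℕ => 1 + 1 / ((N : ℝ) + 1) * (4 / 3)) atTop (𝓝 1) := by
    simpa using (tendsto_one_div_add_atTop_nhds_zero_nat.mul_const (4 / 3 : ℝ)).const_add 1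
  refine tendsto_of_tendsto_of_tendsto_of_le_of_le tendsto_const_nhds hlim (fun N => ?_) fun N => ?_
  · rw [split]
    exact le_add_of_nonneg_right (tsum_nonneg fun k => mul_nonneg (by positivity) (term_pos _ _).le)
  · simp only [split]
    gcongr
    rw [← (hg.mul_left (1 / ((N : ℝ) + 1))).tsum_eq]
    exact (hs N).tsum_le_tsum (factorial_sq_mul_term_succ_le N)
      (hg.mul_left (1 / ((N : ℝ) + 1))).summable

lemma tendsto_factorial_sq_mul_moment_one_div :
    Tendsto (fun N : ℕ => (N ! : ℝ) ^ 2 * moment 1 N / (4 * N + 1)) atTop (𝓝 0) := by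
  have hs : Summable fun k : ℕ => (k : ℝ) ^ 1 * (1 / 4 : ℝ) ^ k :=
    summable_pow_mul_geometric_of_norm_lt_one 1 (by norm_num)
  have hlim : Tendsto (fun N : ℕ => (∑' k : ℕ, (k : ℝ) ^ 1 * (1 / 4 : ℝ) ^ k) / (4 * (N : ℝ) + 1))
      atTop (𝓝 0) :=
    Tendsto.div_atTop tendsto_const_nhds (tendsto_atTop_add_const_right _ _
      (tendsto_natCast_atTop_atTop.const_mul_atTop (by norm_num)))
  refine tendsto_of_tendsto_of_tendsto_of_le_of_le tendsto_const_nhds hlim (fun N => ?_) fun N => ?_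
  · have : 0 ≤ moment 1 N := tsum_nonneg fun k => mul_nonneg (by positivity) (term_pos _ _).le
    positivity
  · dsimp only
    gcongr
    rw [moment, ← tsum_mul_left]
    refine ((summable_pow_mul_term 1 N).mul_left _).tsum_le_tsum (fun k => ?_) hs
    rw [mul_left_comm]
    exact mul_le_mul_of_nonneg_left (factorial_sq_mul_term_le N k) (by positivity)

lemma tendsto_mul_halfRatio_sq :
    Tendsto (fun n : ℕ => (n : ℝ) * halfRatio n ^ 2) atTop (𝓝 (1 / π)) := by
  have hW (n : ℕ) : halfRatio n ^ 2 * ((2 * n + 1) * Wallis.W n) = 1 := by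
    induction n with
    | zero => simp [halfRatio, Wallis.W]
    | succ n ih =>
      refine Eq.trans ?_ ih
      rw [halfRatio_succ, Wallis.W_succ]
      push_cast
      field_simp
      ring
  have h : Tendsto (fun n : ℕ => (n : ℝ) / (2 * n + 1)) atTop (𝓝 (1 / 2)) := by
    have := (tendsto_natCast_div_add_atTop (1 / 2 : ℝ)).div_const 2
    refine this.congr fun n => ?_
    field_simp
  have h2 := h.div Wallis.tendsto_W_nhds_pi_div_two (by positivity)
  have h3 : (1 / 2 : ℝ) / (π / 2) = 1 / π := by field_simp
  rw [h3] at h2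
  refine h2.congr fun n => ?_
  have := Wallis.W_pos n
  have e : halfRatio n ^ 2 = 1 / ((2 * n + 1) * Wallis.W n) := by
    rw [eq_div_iff (by positivity), hW]
  rw [Pi.div_apply, e]
  field_simp

/-- Ramanujan's series `∑ (6k + 1) aₖ³ / 4ᵏ = 4 / π`. -/
lemma moment_zero_add_six_mul_moment_one : moment 0 0 + 6 * moment 1 0 = 4 / π := by
  have hrec (N : ℕ) : halfRatio N ^ 2 * (N ! : ℝ) ^ 2 *
      ((4 * N + 1) * moment 0 N + 6 * moment 1 N) = moment 0 0 + 6 * moment 1 0 := by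
    induction N with
    | zero => simp [halfRatio]
    | succ N ih =>
      rw [← ih, ← moment_recurrence N, halfRatio_succ, Nat.factorial_succ]
      push_cast
      field_simp
      ring
  have h1 := tendsto_factorial_sq_mul_moment_zero.add
    (tendsto_factorial_sq_mul_moment_one_div.const_mul 6)
  have h2 : Tendsto (fun n : ℕ => (4 * (n : ℝ) + 1) * halfRatio n ^ 2) atTop (𝓝 (4 / π)) := by
    have hw := tendsto_mul_halfRatio_sq
    have h0 : Tendsto (fun n : ℕ => halfRatio n ^ 2) atTop (𝓝 0) := by
      refine (hw.div_atTop tendsto_natCast_atTop_atTop).congr' ?_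
      filter_upwards [eventually_gt_atTop 0] with n hn
      field_simp
    have := (hw.const_mul 4).add h0
    rw [mul_one_div, add_zero] at this
    refine this.congr fun n => ?_
    ring
  have h3 := h2.mul h1
  rw [mul_zero, add_zero, mul_one] at h3
  refine tendsto_nhds_unique (tendsto_const_nhds.congr fun N => ?_) h3
  rw [← hrec N]
  field_simp

/-! ### The Clausen formula -/

/-- The ratios `(1/4)ₙ / n!`. -/
noncomputable def quarterRatio (n : ℕ) : ℝ := ∏ i ∈ range n, (4 * (i : ℝ) + 1) / (4 * i + 4)

lemma quarterRatio_succ (n : ℕ) :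
    quarterRatio (n + 1) = quarterRatio n * ((4 * (n : ℝ) + 1) / (4 * n + 4)) :=
  Finset.prod_range_succ _ _

lemma quarterRatio_pos (n : ℕ) : 0 < quarterRatio n :=
  Finset.prod_pos fun _ _ => by positivity

lemma quarterRatio_le_one (n : ℕ) : quarterRatio n ≤ 1 :=
  Finset.prod_le_one (fun _ _ => by positivity) fun i _ => by
    rw [div_le_one (by positivity)]; linarith

open PowerSeries in
/-- The Euler operator `X d/dX` on formal power series. -/
noncomputable def euler : Derivation ℝ ℝ⟦X⟧ ℝ⟦X⟧ := (X : ℝ⟦X⟧) • derivative ℝ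

open PowerSeries in
lemma coeff_euler (f : ℝ⟦X⟧) (n : ℕ) : coeff n (euler f) = n * coeff n f := by
  cases n with
  | zero => simp [euler]
  | succ n =>
    simp [euler, coeff_succ_X_mul, coeff_derivative, mul_comm]

open PowerSeries in
lemma coeff_iterate_euler (f : ℝ⟦X⟧) (i n : ℕ) :
    coeff n (euler^[i] f) = (n : ℝ) ^ i * coeff n f := by
  induction i with
  | zero => simp
  | succ i ih => rw [Function.iterate_succ_apply', coeff_euler, ih]; ring

open PowerSeries in
/-- The hypergeometric series `₂F₁(1/4, 1/4; 1; X)`. -/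
noncomputable def quarterSeries : ℝ⟦X⟧ := mk fun n => quarterRatio n ^ 2

open PowerSeries in
lemma euler_euler_quarterSeries :
    euler (euler quarterSeries) = X * (euler (euler quarterSeries) +
      C (1 / 2) * euler quarterSeries + C (1 / 16) * quarterSeries) := by
  ext n
  cases n with
  | zero => simp [coeff_euler]
  | succ n =>
    simp only [coeff_succ_X_mul, coeff_euler, map_add, coeff_C_mul, quarterSeries, coeff_mk,
      quarterRatio_succ]
    push_cast
    field_simp
    ring

open PowerSeries in
lemma euler_X : euler (X : ℝ⟦X⟧) = X := by
  ext n
  rw [coeff_euler, coeff_X]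
  split_ifs with h <;> simp [h]

open PowerSeries in
lemma euler_C (r : ℝ) : euler (C r : ℝ⟦X⟧) = 0 := by
  ext n
  rw [coeff_euler, coeff_C]
  split_ifs with h <;> simp [h]

open PowerSeries in
/-- The Clausen formula `₂F₁(1/4, 1/4; 1; X)² = ₃F₂(1/2, 1/2, 1/2; 1, 1; X)`. -/
lemma quarterSeries_sq : quarterSeries * quarterSeries = mk fun n => halfRatio n ^ 3 := by
  set g := quarterSeries with hg
  have e2 := euler_euler_quarterSeries
  rw [← hg] at e2
  have e3 := congrArg euler e2
  simp only [Derivation.leibniz, map_add, euler_X, euler_C, smul_eq_mul, mul_zero, add_zero] at e3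
  have hode : euler (euler (euler (g * g))) = X * (euler (euler (euler (g * g))) +
      C (3 / 2) * euler (euler (g * g)) + C (3 / 4) * euler (g * g) + C (1 / 8) * (g * g)) := by
    simp only [Derivation.leibniz, map_add, smul_eq_mul]
    have c1 : (C (1 / 2 : ℝ) : ℝ⟦X⟧) = 8 * C (1 / 16) := by
      rw [← map_ofNat C 8, ← map_mul]; norm_num
    have c2 : (C (3 / 2 : ℝ) : ℝ⟦X⟧) = 24 * C (1 / 16) := by
      rw [← map_ofNat C 24, ← map_mul]; norm_num
    have c3 : (C (3 / 4 : ℝ) : ℝ⟦X⟧) = 12 * C (1 / 16) := by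
      rw [← map_ofNat C 12, ← map_mul]; norm_num
    have c4 : (C (1 / 8 : ℝ) : ℝ⟦X⟧) = 2 * C (1 / 16) := by
      rw [← map_ofNat C 2, ← map_mul]; norm_num
    have c5 : (1 : ℝ⟦X⟧) = 16 * C (1 / 16) := by
      rw [← map_ofNat C 16, ← map_mul]; norm_num
    rw [c1] at e2 e3
    rw [c2, c3, c4]
    linear_combination (2 * g) * e3 + (6 * euler g) * e2 +
      (2 * X * g * euler (euler g)) * c5
  ext n
  rw [coeff_mk]
  induction n with
  | zero => simp [hg, quarterSeries, quarterRatio, halfRatio]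
  | succ n ih =>
    have h := congrArg (coeff (n + 1)) hode
    simp only [coeff_succ_X_mul, coeff_euler, map_add, coeff_C_mul, ih] at h
    rw [halfRatio_succ]
    have hn : ((n : ℝ) + 1) ^ 3 ≠ 0 := by positivity
    refine mul_left_cancel₀ hn ?_
    push_cast at h
    field_simp
    linarith

/-- The moments `∑ₖ kʲ ((1/4)ₖ / k!)² 4⁻ᵏ`. -/
noncomputable def quarterMoment (j : ℕ) : ℝ :=
  ∑' k : ℕ, (k : ℝ) ^ j * quarterRatio k ^ 2 * (1 / 4) ^ k

lemma summable_quarterMoment (j : ℕ) :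
    Summable fun k : ℕ => (k : ℝ) ^ j * quarterRatio k ^ 2 * (1 / 4) ^ k := by
  have hs : Summable fun k : ℕ => (k : ℝ) ^ j * (1 / 4 : ℝ) ^ k :=
    summable_pow_mul_geometric_of_norm_lt_one j (by norm_num)
  refine Summable.of_nonneg_of_le (fun k => by positivity) (fun k => ?_) hs
  gcongr
  exact mul_le_of_le_one_right (by positivity)
    (pow_le_one₀ (quarterRatio_pos k).le (quarterRatio_le_one k))

open PowerSeries in
lemma quarterMoment_mul (i j : ℕ) : quarterMoment i * quarterMoment j =
    ∑' n, coeff n ((euler^[i] quarterSeries) * (euler^[j] quarterSeries)) * (1 / 4) ^ n := by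
  unfold quarterMoment
  rw [tsum_mul_tsum_eq_tsum_sum_antidiagonal_of_summable_norm (summable_quarterMoment i).norm
    (summable_quarterMoment j).norm]
  refine tsum_congr fun n => ?_
  rw [coeff_mul, Finset.sum_mul]
  refine Finset.sum_congr rfl fun x hx => ?_
  rw [coeff_iterate_euler, coeff_iterate_euler, quarterSeries, coeff_mk, coeff_mk,
    ← Finset.HasAntidiagonal.mem_antidiagonal.mp hx, pow_add]
  ring

open PowerSeries in
lemma summable_coeff_mul (i j : ℕ) : Summable fun n =>
    coeff n ((euler^[i] quarterSeries) * (euler^[j] quarterSeries)) * (1 / 4 : ℝ) ^ n := by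
  refine (summable_norm_sum_mul_antidiagonal_of_summable_norm (summable_quarterMoment i).norm
    (summable_quarterMoment j).norm).of_norm.congr fun n => ?_
  rw [coeff_mul, Finset.sum_mul]
  refine Finset.sum_congr rfl fun x hx => ?_
  rw [coeff_iterate_euler, coeff_iterate_euler, quarterSeries, coeff_mk, coeff_mk,
    ← Finset.HasAntidiagonal.mem_antidiagonal.mp hx, pow_add]
  ring

open PowerSeries in
lemma moment_zero_right (j : ℕ) : moment j 0 =
    ∑' n, coeff n (euler^[j] (quarterSeries * quarterSeries)) * (1 / 4) ^ n := by
  refine tsum_congr fun n => ?_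
  rw [coeff_iterate_euler, quarterSeries_sq, coeff_mk, term, zero_add,
    div_self (by positivity), one_div, inv_pow]
  ring

lemma moment_zero_zero : moment 0 0 = quarterMoment 0 ^ 2 := by
  rw [moment_zero_right, sq, quarterMoment_mul]
  rfl

lemma moment_one_zero : moment 1 0 = 2 * (quarterMoment 0 * quarterMoment 1) := by
  rw [moment_zero_right, quarterMoment_mul, ← tsum_mul_left]
  refine tsum_congr fun n => ?_
  simp only [Function.iterate_succ_apply, Function.iterate_zero_apply, Derivation.leibniz,
    smul_eq_mul, map_add]
  ring

lemma moment_two_zero :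
    moment 2 0 = 2 * quarterMoment 1 ^ 2 + 2 * (quarterMoment 0 * quarterMoment 2) := by
  rw [moment_zero_right, sq (quarterMoment 1), quarterMoment_mul, quarterMoment_mul,
    ← tsum_mul_left, ← tsum_mul_left,
    ← ((summable_coeff_mul 1 1).mul_left 2).tsum_add ((summable_coeff_mul 0 2).mul_left 2)]
  refine tsum_congr fun n => ?_
  simp only [Function.iterate_succ_apply, Function.iterate_zero_apply, Derivation.leibniz,
    smul_eq_mul, map_add]
  ring

lemma quarterMoment_two :
    quarterMoment 2 = (quarterMoment 1 / 2 + quarterMoment 0 / 16) / 3 := by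
  have h0 := summable_quarterMoment 0
  have h1 := summable_quarterMoment 1
  have h2 := summable_quarterMoment 2
  have key : quarterMoment 2 =
      (quarterMoment 2 + (1 / 2) * quarterMoment 1 + (1 / 16) * quarterMoment 0) * (1 / 4) := by
    conv_lhs => rw [quarterMoment, h2.tsum_eq_zero_add]
    unfold quarterMoment
    rw [← tsum_mul_left, ← tsum_mul_left, ← h2.tsum_add (h1.mul_left _),
      ← (h2.add (h1.mul_left _)).tsum_add (h0.mul_left _), ← tsum_mul_right]
    simp only [CharP.cast_eq_zero, ne_eq, OfNat.ofNat_ne_zero, not_false_eq_true, zero_pow,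
      zero_mul, zero_add]
    refine tsum_congr fun n => ?_
    rw [quarterRatio_succ, pow_succ]
    push_cast
    field_simp
    ring
  linarith

lemma moment_legendre : moment 0 0 * (4 * moment 0 0 - moment 0 1) = 32 / π ^ 2 := by
  have h1 := moment_zero_add_six_mul_moment_one
  rw [moment_zero_one]
  rw [moment_zero_zero, moment_one_zero] at h1
  rw [moment_two_zero, moment_zero_zero, quarterMoment_two]
  have h2 : (32 : ℝ) / π ^ 2 = 2 * (4 / π) ^ 2 := by ring
  rw [h2, ← h1]
  ring

/-! ### The value of `₂F₁(1/4, 1/4; 1; 1/4)` -/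

section Integrals

open MeasureTheory Set ProbabilityTheory

lemma integral_rpow_mul_one_sub_rpow {α β : ℝ} (hα : 0 < α) (hβ : 0 < β) :
    ∫ x in Ioo (0 : ℝ) 1, x ^ (α - 1) * (1 - x) ^ (β - 1) = beta α β := by
  rw [beta_eq_betaIntegralReal α β hα hβ, Complex.betaIntegral,
    intervalIntegral.integral_of_le (by norm_num), ← integral_Ioc_eq_integral_Ioo,
    ← RCLike.re_to_complex, ← integral_re]
  · refine setIntegral_congr_fun measurableSet_Ioc fun x ⟨hx1, hx2⟩ ↦ ?_
    norm_cast
    rw [← Complex.ofReal_cpow, ← Complex.ofReal_cpow, RCLike.re_to_complex,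
      Complex.re_mul_ofReal, Complex.ofReal_re]
    all_goals linarith
  · convert! Complex.betaIntegral_convergent (u := α) (v := β) (by simpa) (by simpa)
    rw [intervalIntegrable_iff_integrableOn_Ioc_of_le (by simp), IntegrableOn]

lemma integrableOn_rpow_mul_one_sub_rpow {α β : ℝ} (hα : 0 < α) (hβ : 0 < β) :
    IntegrableOn (fun x : ℝ => x ^ (α - 1) * (1 - x) ^ (β - 1)) (Ioo 0 1) := by
  refine Integrable.of_integral_ne_zero ?_
  rw [integral_rpow_mul_one_sub_rpow hα hβ]
  exact (beta_pos hα hβ).ne'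

lemma ringChoose_eq_quarterRatio (n : ℕ) : Ring.choose ((1 / 4 : ℝ) + n - 1) n = quarterRatio n := by
  have h (n : ℕ) : (n ! : ℝ) * quarterRatio n = (ascPochhammer ℝ n).eval (1 / 4) := by
    induction n with
    | zero => simp [quarterRatio]
    | succ n ih =>
      rw [ascPochhammer_succ_eval, ← ih, quarterRatio_succ, Nat.factorial_succ]
      push_cast
      field_simp
      ring
  have h2 := Ring.factorial_nsmul_multichoose_eq_ascPochhammer (1 / 4 : ℝ) n
  rw [Polynomial.ascPochhammer_smeval_eq_eval, ← h n, nsmul_eq_mul] at h2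
  have h3 : Ring.choose ((1 / 4 : ℝ) + n - 1) n = Ring.multichoose (1 / 4 : ℝ) n := by
    rw [Ring.choose]; congr 1; ring
  rw [h3]
  exact mul_left_cancel₀ (by positivity) h2

lemma hasSum_quarterRatio_mul_pow {x : ℝ} (hx : |x| < 1) :
    HasSum (fun n => quarterRatio n * x ^ n) ((1 - x) ^ (-(1 / 4) : ℝ)) := by
  have h := (one_div_one_sub_rpow_hasFPowerSeriesOnBall_zero (1 / 4)).hasSum (y := x)
    (by simpa [enorm_eq_nnnorm, ← NNReal.coe_lt_coe] using hx)
  rw [zero_add, one_div ((1 - x) ^ (1 / 4 : ℝ)),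
    ← rpow_neg (by linarith [(abs_lt.mp hx).2])] at h
  refine h.congr_fun fun n => ?_
  rw [← ringChoose_eq_quarterRatio]
  simp [mul_comm]

lemma beta_natCast_add_quarter (n : ℕ) :
    beta (n + 1 / 4) (3 / 4) = quarterRatio n * beta (1 / 4) (3 / 4) := by
  induction n with
  | zero => simp [quarterRatio]
  | succ n ih =>
    rw [quarterRatio_succ, mul_right_comm, ← ih]
    unfold beta
    have e1 : ((n + 1 : ℕ) : ℝ) + 1 / 4 = (n + 1 / 4) + 1 := by push_cast; ring
    have e2 : (n : ℝ) + 1 / 4 + 1 + 3 / 4 = (n + 1) + 1 := by ring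
    have e3 : (n : ℝ) + 1 / 4 + 3 / 4 = n + 1 := by ring
    rw [e1, e2, e3, Gamma_add_one (by positivity), Gamma_add_one (s := (n : ℝ) + 1) (by positivity)]
    have := (Gamma_pos_of_pos (show (0 : ℝ) < n + 1 by positivity)).ne'
    field_simp

lemma integral_quarter : ∫ t in Ioo (0 : ℝ) 1,
    t ^ (-(3 / 4) : ℝ) * (1 - t) ^ (-(1 / 4) : ℝ) * (1 - t / 4) ^ (-(1 / 4) : ℝ) =
      beta (1 / 4) (3 / 4) * quarterMoment 0 := by
  set F : ℕ → ℝ → ℝ := fun n t =>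
    quarterRatio n * (1 / 4) ^ n * (t ^ ((n + 1 / 4 : ℝ) - 1) * (1 - t) ^ ((3 / 4 : ℝ) - 1)) with hF
  have hint (n : ℕ) : ∫ t in Ioo (0 : ℝ) 1, F n t =
      beta (1 / 4) (3 / 4) * ((n : ℝ) ^ 0 * quarterRatio n ^ 2 * (1 / 4) ^ n) := by
    rw [hF, integral_const_mul, integral_rpow_mul_one_sub_rpow (by positivity) (by norm_num),
      beta_natCast_add_quarter]
    ring
  have hnorm (n : ℕ) : ∫ t in Ioo (0 : ℝ) 1, ‖F n t‖ = ∫ t in Ioo (0 : ℝ) 1, F n t := by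
    refine setIntegral_congr_fun measurableSet_Ioo fun t ht => ?_
    have h1 : 0 < 1 - t := by linarith [ht.2]
    have h2 := ht.1
    have h3 := quarterRatio_pos n
    exact Real.norm_of_nonneg (by positivity)
  have hs := hasSum_integral_of_summable_integral_norm (μ := volume.restrict (Ioo (0 : ℝ) 1))
    (F := F)
    (fun n => (integrableOn_rpow_mul_one_sub_rpow (by positivity) (by norm_num)).const_mul _)
    (by simpa only [hnorm, hint] using (summable_quarterMoment 0).mul_left _)
  have hsum : ∑' n, ∫ t in Ioo (0 : ℝ) 1, F n t = beta (1 / 4) (3 / 4) * quarterMoment 0 := by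
    simp only [hint, tsum_mul_left, quarterMoment]
  rw [← hsum, hs.tsum_eq]
  refine setIntegral_congr_fun measurableSet_Ioo fun t ht => ?_
  have h := (hasSum_quarterRatio_mul_pow (x := t / 4)
    (by rw [abs_lt]; constructor <;> linarith [ht.1, ht.2])).mul_left
      (t ^ (-(3 / 4) : ℝ) * (1 - t) ^ (-(1 / 4) : ℝ))
  rw [← h.tsum_eq]
  refine tsum_congr fun n => ?_
  have e : (n + 1 / 4 : ℝ) - 1 = n + -(3 / 4) := by ring
  rw [hF]
  dsimp only
  rw [e, rpow_add ht.1, rpow_natCast, div_pow, one_div_pow]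
  norm_num
  ring

/-- The integrand of the complete elliptic integral `∫ √r dr / √((1 + 3r²)(3 + r²))`. -/
noncomputable def ellipticIntegrand (r : ℝ) : ℝ := √r / √((1 + 3 * r ^ 2) * (3 + r ^ 2))

lemma integral_ellipticIntegrand_Ioi : ∫ r in Ioi (0 : ℝ), ellipticIntegrand r =
    √3 / 6 * (3 / 4) ^ (1 / 4 : ℝ) * (beta (1 / 4) (3 / 4) * quarterMoment 0) := by
  set f : ℝ → ℝ := fun t => (4 - 5 * t + t ^ 2) / (3 * t) with hf
  have hpos {t : ℝ} (ht : t ∈ Ioo (0 : ℝ) 1) : 0 < f t :=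
    div_pos (by nlinarith [ht.1, ht.2]) (by linarith [ht.1])
  have himage : (fun t => √(f t)) '' Ioo 0 1 = Ioi 0 := by
    ext r
    refine ⟨?_, fun hr => ?_⟩
    · rintro ⟨t, ht, rfl⟩
      exact sqrt_pos.mpr (hpos ht)
    · have hr : 0 < r := hr
      obtain ⟨t, ht, h⟩ := intermediate_value_Ioo' (zero_le_one (α := ℝ))
        (f := fun t : ℝ => 4 - 5 * t + t ^ 2 - 3 * r ^ 2 * t) (by fun_prop)
        (show (0 : ℝ) ∈ Ioo _ _ by constructor <;> norm_num <;> positivity)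
      refine ⟨t, ht, ?_⟩
      have ht0 := ht.1
      have : f t = r ^ 2 := by
        rw [hf]
        dsimp only at h ⊢
        rw [div_eq_iff (by positivity)]
        linarith
      simp only [this, sqrt_sq hr.le]
  have hderiv : ∀ t ∈ Ioo (0 : ℝ) 1, HasDerivWithinAt (fun t => √(f t))
      ((t ^ 2 - 4) / (3 * t ^ 2) / (2 * √(f t))) (Ioo 0 1) t := by
    intro t ht
    have ht0 := ht.1.ne'
    have h1 : HasDerivAt f ((t ^ 2 - 4) / (3 * t ^ 2)) t := by
      have := (((hasDerivAt_id t).const_mul 5).const_sub 4 |>.add ((hasDerivAt_id t).pow 2)).div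
        ((hasDerivAt_id t).const_mul 3) (by simpa using ht0)
      refine this.congr_deriv ?_
      simp
      field_simp
      ring
    exact (h1.sqrt (hpos ht).ne').hasDerivWithinAt
  have hinj : InjOn (fun t => √(f t)) (Ioo 0 1) := by
    intro s hs t ht h
    have h' : f s = f t := (sqrt_inj (hpos hs).le (hpos ht).le).mp h
    have hs0 := hs.1
    have ht0 := ht.1
    rw [hf] at h'
    dsimp only at h'
    rw [div_eq_div_iff (by positivity) (by positivity)] at h'
    have h2 : (s - t) * (s * t - 4) = 0 := by linarith
    rcases mul_eq_zero.mp h2 with h3 | h3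
    · linarith
    · nlinarith [hs.2, ht.2]
  rw [← himage, integral_image_eq_integral_abs_deriv_smul measurableSet_Ioo hderiv hinj,
    ← integral_quarter, ← integral_const_mul]
  refine setIntegral_congr_fun measurableSet_Ioo fun t ht => ?_
  have ht0 := ht.1
  have ht1 : 0 < 1 - t := by linarith [ht.2]
  have ht4 : 0 < 1 - t / 4 := by linarith [ht.2]
  have hft := hpos ht
  have hden : √((1 + 3 * √(f t) ^ 2) * (3 + √(f t) ^ 2)) = (4 - t ^ 2) / (√3 * t) := by
    rw [sq_sqrt hft.le, sqrt_eq_iff_mul_self_eq (by positivity)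
      (div_nonneg (by nlinarith) (by positivity)), hf]
    have h3 : √3 * √3 = (3 : ℝ) := mul_self_sqrt (by norm_num)
    field_simp
    rw [sq (√3), h3]
    ring
  have hroot : √√(f t) = t ^ (-(1 / 4) : ℝ) * (1 - t) ^ (1 / 4 : ℝ) * (1 - t / 4) ^ (1 / 4 : ℝ) /
      (3 / 4) ^ (1 / 4 : ℝ) := by
    have e : f t = (1 - t) * (1 - t / 4) / (3 / 4 * t) := by
      rw [hf]; field_simp; ring
    rw [sqrt_eq_rpow, sqrt_eq_rpow, ← rpow_mul hft.le, e, div_rpow (by positivity) (by positivity),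
      mul_rpow ht1.le ht4.le, mul_rpow (by norm_num) ht0.le, rpow_neg ht0.le]
    norm_num
    field_simp
  have hneg : (t ^ 2 - 4) / (3 * t ^ 2) / (2 * √(f t)) ≤ 0 :=
    div_nonpos_of_nonpos_of_nonneg
      (div_nonpos_of_nonpos_of_nonneg (by nlinarith) (by positivity)) (by positivity)
  have hne : (4 : ℝ) - t ^ 2 ≠ 0 := by nlinarith
  rw [smul_eq_mul, ellipticIntegrand, hden, abs_of_nonpos hneg]
  have hs : √(f t) = √√(f t) ^ 2 := (sq_sqrt (sqrt_nonneg _)).symm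
  have hs0 : 0 < √√(f t) := sqrt_pos.mpr (sqrt_pos.mpr hft)
  have hstep : -((t ^ 2 - 4) / (3 * t ^ 2) / (2 * √(f t))) * (√√(f t) / ((4 - t ^ 2) / (√3 * t))) =
      √3 / 6 / (t * √√(f t)) := by
    clear hroot hden hneg
    generalize √√(f t) = y at hs hs0 ⊢
    rw [hs]
    field_simp
    ring
  rw [hstep, hroot, rpow_neg ht0.le, rpow_neg ht1.le, rpow_neg ht4.le, rpow_neg ht0.le]
  have e34 : t = t ^ (3 / 4 : ℝ) * t ^ (1 / 4 : ℝ) := by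
    rw [← rpow_add ht0]; norm_num
  have : t / t ^ (1 / 4 : ℝ) = t ^ (3 / 4 : ℝ) := by
    rw [div_eq_iff (by positivity)]; exact e34
  rw [← this]
  field_simp

lemma integrableOn_ellipticIntegrand : IntegrableOn ellipticIntegrand (Ioi 0) := by
  refine Integrable.of_integral_ne_zero ?_
  rw [integral_ellipticIntegrand_Ioi]
  have h1 : 0 < beta (1 / 4) (3 / 4) := beta_pos (by norm_num) (by norm_num)
  have h2 : 0 < quarterMoment 0 := (summable_quarterMoment 0).tsum_pos
    (fun k => by positivity) 0 (by simp [quarterRatio])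
  positivity

lemma integral_ellipticIntegrand_Ioi_eq_Ioo : ∫ r in Ioi (0 : ℝ), ellipticIntegrand r =
    ∫ r in Ioo (0 : ℝ) 1, (1 + r) / (√r * √((1 + 3 * r ^ 2) * (3 + r ^ 2))) := by
  have himage : (fun r : ℝ => r⁻¹) '' Ioo 0 1 = Ioi 1 := by
    rw [image_inv_eq_inv, inv_Ioo_0_left one_pos, inv_one]
  have hderiv : ∀ r ∈ Ioo (0 : ℝ) 1,
      HasDerivWithinAt (fun r : ℝ => r⁻¹) (-(r ^ 2)⁻¹) (Ioo 0 1) r :=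
    fun r hr => (hasDerivAt_inv hr.1.ne').hasDerivWithinAt
  have hinj : InjOn (fun r : ℝ => r⁻¹) (Ioo 0 1) := inv_injective.injOn
  have hint := integrableOn_ellipticIntegrand
  have hint1 : IntegrableOn ellipticIntegrand ((fun r : ℝ => r⁻¹) '' Ioo 0 1) := by
    rw [himage]; exact hint.mono_set (Ioi_subset_Ioi zero_le_one)
  have hunion : Ioi (0 : ℝ) = Ioo 0 1 ∪ Ici 1 := (Ioo_union_Ici_eq_Ioi one_pos).symm
  have hdisj : Disjoint (Ioo (0 : ℝ) 1) (Ici 1) :=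
    disjoint_left.mpr fun x hx hx' => absurd hx.2 (not_lt.mpr hx')
  rw [hunion, setIntegral_union hdisj measurableSet_Ici
    (hint.mono_set Ioo_subset_Ioi_self)
    (hint.mono_set (Ici_subset_Ioi.mpr one_pos)), integral_Ici_eq_integral_Ioi, ← himage,
    integral_image_eq_integral_abs_deriv_smul measurableSet_Ioo hderiv hinj,
    ← integral_add (hint.mono_set Ioo_subset_Ioi_self)
      ((integrableOn_image_iff_integrableOn_abs_deriv_smul measurableSet_Ioo hderiv hinj _).mp
        hint1)]
  refine setIntegral_congr_fun measurableSet_Ioo fun r hr => ?_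
  have h0 : 0 < r := hr.1
  have hs : √r * √r = r := mul_self_sqrt h0.le
  have hs0 : 0 < √r := sqrt_pos.mpr h0
  have e : (1 + 3 * r⁻¹ ^ 2) * (3 + r⁻¹ ^ 2) = (1 + 3 * r ^ 2) * (3 + r ^ 2) / (r ^ 2) ^ 2 := by
    field_simp
    ring
  have hQ : 0 < √((1 + 3 * r ^ 2) * (3 + r ^ 2)) := by positivity
  dsimp only [ellipticIntegrand]
  rw [e, sqrt_div (by positivity), sqrt_sq (by positivity), sqrt_inv, abs_neg,
    abs_of_pos (by positivity), smul_eq_mul]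
  field_simp
  nlinarith

lemma integral_ellipticIntegrand_Ioo :
    ∫ r in Ioo (0 : ℝ) 1, (1 + r) / (√r * √((1 + 3 * r ^ 2) * (3 + r ^ 2))) =
      beta (1 / 6) (1 / 2) / 6 := by
  have hD (r : ℝ) : 0 < 3 * r ^ 2 - 2 * r + 3 := by nlinarith [sq_nonneg (r - 1)]
  set v : ℝ → ℝ := fun r => 4 * r / (3 * r ^ 2 - 2 * r + 3) with hv
  have hv0 {r : ℝ} (hr : r ∈ Ioo (0 : ℝ) 1) : 0 < v r := div_pos (by linarith [hr.1]) (hD r)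
  have hv1 {r : ℝ} (hr : r ∈ Ioo (0 : ℝ) 1) : v r < 1 := by
    rw [hv]
    dsimp only
    rw [div_lt_one (hD r)]
    nlinarith [mul_pos (sub_pos.mpr hr.2) (sub_pos.mpr hr.2)]
  have himage : (fun r => v r ^ 3) '' Ioo 0 1 = Ioo 0 1 := by
    refine Subset.antisymm ?_ ?_
    · rintro _ ⟨r, hr, rfl⟩
      exact ⟨pow_pos (hv0 hr) 3, pow_lt_one₀ (hv0 hr).le (hv1 hr) three_ne_zero⟩
    · have hcont : ContinuousOn (fun r => v r ^ 3) (Icc 0 1) := by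
        refine Continuous.continuousOn (Continuous.pow (Continuous.div ?_ ?_ fun r => (hD r).ne') 3)
        · fun_prop
        · fun_prop
      have := intermediate_value_Ioo (zero_le_one (α := ℝ)) hcont
      norm_num [hv] at this ⊢
      exact this
  have hderiv : ∀ r ∈ Ioo (0 : ℝ) 1, HasDerivWithinAt (fun r => v r ^ 3)
      (3 * v r ^ 2 * (12 * (1 - r ^ 2) / (3 * r ^ 2 - 2 * r + 3) ^ 2)) (Ioo 0 1) r := by
    intro r hr
    have h1 : HasDerivAt v (12 * (1 - r ^ 2) / (3 * r ^ 2 - 2 * r + 3) ^ 2) r := by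
      have := ((hasDerivAt_id r).const_mul 4).div
        (((((hasDerivAt_id r).pow 2).const_mul 3).sub ((hasDerivAt_id r).const_mul 2)).add_const 3)
        (by simpa using (hD r).ne')
      refine this.congr_deriv ?_
      simp
      have := (hD r).ne'
      field_simp
      ring
    exact ((h1.pow 3).congr_deriv (by norm_num)).hasDerivWithinAt
  have hinj : InjOn (fun r => v r ^ 3) (Ioo 0 1) := by
    intro s hs t ht h
    have h' : v s = v t := (pow_left_inj₀ (hv0 hs).le (hv0 ht).le three_ne_zero).mp h
    rw [hv] at h'
    dsimp only at h'
    rw [div_eq_div_iff (hD s).ne' (hD t).ne'] at h'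
    have h2 : (s - t) * (1 - s * t) = 0 := by linarith
    rcases mul_eq_zero.mp h2 with h3 | h3
    · linarith
    · nlinarith [hs.1, hs.2, ht.1, ht.2]
  have hb := integral_rpow_mul_one_sub_rpow (α := 1 / 6) (β := 1 / 2) (by norm_num) (by norm_num)
  rw [← himage, integral_image_eq_integral_abs_deriv_smul measurableSet_Ioo hderiv hinj] at hb
  rw [← hb, eq_div_iff (by norm_num), mul_comm, ← integral_const_mul]
  refine setIntegral_congr_fun measurableSet_Ioo fun r hr => ?_
  have h0 : 0 < r := hr.1
  have h1 : 0 < 1 - r := by linarith [hr.2]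
  have hvp := hv0 hr
  have hDr := hD r
  set D := 3 * r ^ 2 - 2 * r + 3 with hDdef
  have hQ : 0 < (1 + 3 * r ^ 2) * (3 + r ^ 2) := by positivity
  have e1 : (v r ^ 3) ^ ((1 / 6 : ℝ) - 1) = (v r ^ 2 * √(v r))⁻¹ := by
    rw [sqrt_eq_rpow, ← rpow_natCast (v r) 3, ← rpow_natCast (v r) 2, ← rpow_mul hvp.le,
      ← rpow_add hvp, ← rpow_neg hvp.le]
    norm_num
  have e2 : (1 - v r ^ 3) ^ ((1 / 2 : ℝ) - 1) = (√(1 - v r ^ 3))⁻¹ := by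
    have : (0 : ℝ) ≤ 1 - v r ^ 3 := by
      linarith [pow_lt_one₀ hvp.le (hv1 hr) three_ne_zero]
    rw [sqrt_eq_rpow, ← rpow_neg this]
    norm_num
  have e3 : √(v r) * √(1 - v r ^ 3) =
      6 * (1 - r) * (√r * √((1 + 3 * r ^ 2) * (3 + r ^ 2))) / D ^ 2 := by
    rw [← sqrt_mul hvp.le, sqrt_eq_iff_mul_self_eq_of_pos (by positivity)]
    have hs : √r * √r = r := mul_self_sqrt h0.le
    have hs2 := mul_self_sqrt hQ.le
    have : 6 * (1 - r) * (√r * √((1 + 3 * r ^ 2) * (3 + r ^ 2))) / D ^ 2 *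
        (6 * (1 - r) * (√r * √((1 + 3 * r ^ 2) * (3 + r ^ 2))) / D ^ 2) =
        36 * (1 - r) ^ 2 * ((√r * √r) * (√((1 + 3 * r ^ 2) * (3 + r ^ 2)) *
          √((1 + 3 * r ^ 2) * (3 + r ^ 2)))) / D ^ 4 := by ring_nf
    rw [this, hs, hs2]
    have hvr : v r = 4 * r / D := rfl
    rw [hvr]
    field_simp
    rw [hDdef]
    ring
  have hd : 0 ≤ 3 * v r ^ 2 * (12 * (1 - r ^ 2) / D ^ 2) := by
    have : 0 ≤ 1 - r ^ 2 := by nlinarith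
    positivity
  rw [smul_eq_mul, e1, e2, abs_of_nonneg hd, mul_inv, mul_assoc (v r ^ 2)⁻¹, ← mul_inv, e3]
  have hsr : 0 < √r := sqrt_pos.mpr h0
  have hsQ := sqrt_pos.mpr hQ
  field_simp
  ring

end Integrals

/-! ### The closed form of the limit -/

section ClosedForm

open ProbabilityTheory

lemma beta_quarter : beta (1 / 4) (3 / 4) = π * √2 := by
  have h := Gamma_mul_Gamma_one_sub (1 / 4)
  have e : (1 : ℝ) - 1 / 4 = 3 / 4 := by norm_num
  have hs : π * (1 / 4) = π / 4 := by ring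
  rw [e, hs, sin_pi_div_four] at h
  have e1 : (1 / 4 : ℝ) + 3 / 4 = 1 := by norm_num
  have h2 : √2 * √2 = (2 : ℝ) := mul_self_sqrt (by norm_num)
  rw [beta, e1, Gamma_one, div_one, h, div_div_eq_mul_div, div_eq_iff (by positivity),
    mul_assoc, h2]

lemma beta_sixth :
    beta (1 / 6) (1 / 2) = (2 : ℝ) ^ (2 / 3 : ℝ) * π * Gamma (1 / 3) / Gamma (2 / 3) ^ 2 := by
  have h := Gamma_mul_Gamma_add_half (1 / 6)
  have e1 : (1 / 6 : ℝ) + 1 / 2 = 2 / 3 := by norm_num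
  have e2 : (2 : ℝ) * (1 / 6) = 1 / 3 := by norm_num
  have e3 : (1 : ℝ) - 1 / 3 = 2 / 3 := by norm_num
  rw [e1, e2, e3] at h
  have h2 := (Gamma_pos_of_pos (show (0 : ℝ) < 2 / 3 by norm_num)).ne'
  have hπ : √π * √π = π := mul_self_sqrt pi_pos.le
  rw [beta, e1, Gamma_one_half_eq, div_eq_div_iff h2 (pow_ne_zero 2 h2)]
  linear_combination √π * Gamma (2 / 3) * h +
    Gamma (1 / 3) * Gamma (2 / 3) * (2 : ℝ) ^ (2 / 3 : ℝ) * hπ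

/-- The limit of the continued fraction. -/
noncomputable def cfLimit : ℝ := (2 : ℝ) ^ (-(1 : ℝ) / 3) * (Gamma (1 / 3) / Gamma (2 / 3)) ^ 6

lemma cfLimit_pos : 0 < cfLimit := by
  have h1 := Gamma_pos_of_pos (show (0 : ℝ) < 1 / 3 by norm_num)
  have h2 := Gamma_pos_of_pos (show (0 : ℝ) < 2 / 3 by norm_num)
  unfold cfLimit
  positivity

lemma cfLimit_eq : cfLimit = 9 * π ^ 2 * moment 0 0 ^ 2 / 2 := by
  have h := congrArg (· ^ 4) (integral_ellipticIntegrand_Ioi.symm.trans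
    (integral_ellipticIntegrand_Ioi_eq_Ioo.trans integral_ellipticIntegrand_Ioo))
  have h1 := (Gamma_pos_of_pos (show (0 : ℝ) < 1 / 3 by norm_num)).ne'
  have h2 := (Gamma_pos_of_pos (show (0 : ℝ) < 2 / 3 by norm_num)).ne'
  have hrefl := Gamma_mul_Gamma_one_sub (1 / 3)
  have e3 : (1 : ℝ) - 1 / 3 = 2 / 3 := by norm_num
  have e4 : π * (1 / 3) = π / 3 := by ring
  rw [e3, e4, sin_pi_div_three] at hrefl
  have s3 : √3 ^ 2 = (3 : ℝ) := sq_sqrt (by norm_num)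
  have s2 : √2 ^ 2 = (2 : ℝ) := sq_sqrt (by norm_num)
  have hg : 3 * (Gamma (1 / 3) * Gamma (2 / 3)) ^ 2 = 4 * π ^ 2 := by
    rw [hrefl, div_pow, div_pow, s3]
    field_simp
    norm_num
  have hp : ((3 / 4 : ℝ) ^ (1 / 4 : ℝ)) ^ 4 = 3 / 4 := by
    rw [← rpow_natCast, ← rpow_mul (by norm_num)]
    norm_num
  have hq : ((2 : ℝ) ^ (2 / 3 : ℝ)) ^ 4 = 8 * (2 : ℝ) ^ (-(1 : ℝ) / 3) := by
    rw [← rpow_natCast, ← rpow_mul (by norm_num),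
      show (2 / 3 : ℝ) * (4 : ℕ) = 3 + -(1 : ℝ) / 3 by norm_num, rpow_add (by norm_num)]
    norm_num
  have s34 : √3 ^ 4 = (9 : ℝ) := by rw [show √3 ^ 4 = (√3 ^ 2) ^ 2 by ring, s3]; norm_num
  have s24 : √2 ^ 4 = (4 : ℝ) := by rw [show √2 ^ 4 = (√2 ^ 2) ^ 2 by ring, s2]; norm_num
  simp only [beta_quarter, beta_sixth, mul_pow, div_pow, hp, hq, s34, s24] at h
  rw [moment_zero_zero, cfLimit, div_pow]
  set c := (2 : ℝ) ^ (-(1 : ℝ) / 3)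
  have hπ := pi_pos.ne'
  field_simp at h ⊢
  generalize Gamma (1 / 3) = x at *
  generalize Gamma (2 / 3) = y at *
  linear_combination -(x ^ 2 / 4) * h + 9 / 4 * quarterMoment 0 ^ 4 * y ^ 6 * hg

end ClosedForm

/-! ### The remainders of the continued fraction -/

/-- The positive solution of the recurrence that is minimal at infinity. -/
noncomputable def minimalSolution (m : ℕ) : ℝ :=
  4 * 4 ^ m * ((m ! : ℝ) * halfRatio m) ^ 4 * moment 0 m

lemma factorial_mul_halfRatio_succ (m : ℕ) :
    ((m + 1)! : ℝ) * halfRatio (m + 1) = (2 * m + 1) / 2 * ((m ! : ℝ) * halfRatio m) := by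
  rw [halfRatio_succ, Nat.factorial_succ]
  push_cast
  field_simp

lemma minimalSolution_pos (m : ℕ) : 0 < minimalSolution m := by
  have h1 := halfRatio_pos m
  have h2 := moment_zero_pos m
  unfold minimalSolution
  positivity

lemma minimalSolution_zero : minimalSolution 0 = 4 * moment 0 0 := by
  simp [minimalSolution, halfRatio]

lemma minimalSolution_one : minimalSolution 1 = moment 0 1 := by
  norm_num [minimalSolution, halfRatio]

lemma minimalSolution_add_two (m : ℕ) : minimalSolution (m + 2) =
    (40 * (m + 1 : ℝ) ^ 2 + 2) * minimalSolution (m + 1) -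
      9 * (2 * (m : ℝ) + 1) ^ 4 * minimalSolution m := by
  have h := moment_zero_recurrence m
  unfold minimalSolution
  rw [factorial_mul_halfRatio_succ (m + 1), factorial_mul_halfRatio_succ m]
  push_cast
  linear_combination (16 / 16 * 4 * 4 ^ m *
    ((2 * m + 1) / 2 * ((m ! : ℝ) * halfRatio m)) ^ 4) * h

lemma cfLimit_mul_minimalSolution_one :
    cfLimit / (4 * moment 0 0) * minimalSolution 1 = cfLimit - 36 := by
  have h := moment_legendre
  have h0 := (moment_zero_pos 0).ne'
  have hπ := pi_pos.ne'
  rw [minimalSolution_one, cfLimit_eq]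
  field_simp at h ⊢
  linear_combination -9 * h

lemma eq_mul_minimalSolution {u : ℕ → ℝ}
    (hu : ∀ n : ℕ, u (n + 2) =
      (40 * (n + 2 : ℝ) ^ 2 + 2) * u (n + 1) - 9 * (2 * (n : ℝ) + 3) ^ 4 * u n)
    (h0 : u 0 = cfLimit - 36) (h1 : u 1 = 33 * cfLimit - 1512) (n : ℕ) :
    u n = cfLimit / (4 * moment 0 0) * minimalSolution (n + 1) := by
  induction n using Nat.twoStepInduction with
  | zero => rw [h0, zero_add, cfLimit_mul_minimalSolution_one]
  | one =>
    have h2 := minimalSolution_add_two 0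
    have h3 := cfLimit_mul_minimalSolution_one
    have h4 : cfLimit / (4 * moment 0 0) * minimalSolution 0 = cfLimit := by
      rw [minimalSolution_zero, div_mul_cancel₀]
      have := moment_zero_pos 0
      positivity
    norm_num at h2
    rw [h1, h2]
    linear_combination 9 * h4 - 42 * h3
  | more n ih1 ih2 =>
    have h2 := minimalSolution_add_two (n + 1)
    rw [hu, ih1, ih2, h2]
    push_cast
    ring

/-! ### Growth of the denominators -/

lemma denominator_growth {q : ℕ → ℝ}
    (hq : ∀ n : ℕ, q (n + 2) =
      (40 * (n + 2 : ℝ) ^ 2 + 2) * q (n + 1) - 9 * (2 * (n : ℝ) + 3) ^ 4 * q n)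
    (hq0 : q 0 = 1) (hq1 : q 1 = 33) (n : ℕ) :
    0 < q n ∧ 3 * (2 * (n : ℝ) + 3) ^ 2 * q n ≤ q (n + 1) := by
  induction n with
  | zero => norm_num [hq0, hq1]
  | succ n ih =>
    obtain ⟨h0, h1⟩ := ih
    have hpos : 0 < q (n + 1) := lt_of_lt_of_le (by positivity) h1
    refine ⟨hpos, ?_⟩
    rw [hq n]
    push_cast
    have h2 := mul_le_mul_of_nonneg_left h1 (show 0 ≤ 3 * (2 * (n : ℝ) + 3) ^ 2 by positivity)
    have h3 : 0 ≤ (16 * (n : ℝ) ^ 2 + 64 * n + 60) * q (n + 1) := by positivity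
    linarith

lemma casoratian {p q : ℕ → ℝ}
    (hp : ∀ n : ℕ, p (n + 2) =
      (40 * (n + 2 : ℝ) ^ 2 + 2) * p (n + 1) - 9 * (2 * (n : ℝ) + 3) ^ 4 * p n)
    (hq : ∀ n : ℕ, q (n + 2) =
      (40 * (n + 2 : ℝ) ^ 2 + 2) * q (n + 1) - 9 * (2 * (n : ℝ) + 3) ^ 4 * q n)
    (h0 : p 1 * q 0 - p 0 * q 1 = 324) (n : ℕ) :
    p (n + 1) * q n - p n * q (n + 1) =
      36 * 144 ^ (n + 1) * (((n + 1)! : ℝ) * halfRatio (n + 1)) ^ 4 := by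
  induction n with
  | zero => norm_num [h0, halfRatio]
  | succ n ih =>
    rw [hp n, hq n, factorial_mul_halfRatio_succ (n + 1), pow_succ _ (n + 1)]
    push_cast
    linear_combination 9 * (2 * (n : ℝ) + 3) ^ 4 * ih

/-! ### The speed of convergence -/

lemma tendsto_of_tendsto_sub_mul {x : ℕ → ℝ} {a c : ℝ} (ha0 : 0 ≤ a) (ha1 : a < 1)
    (h : Tendsto (fun n => x (n + 1) - a * x n) atTop (𝓝 c)) :
    Tendsto x atTop (𝓝 (c / (1 - a))) := by
  have ha : 0 < 1 - a := by linarith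
  set l := c / (1 - a) with hl
  have hlc : l - a * l = c := by rw [hl]; field_simp
  rw [Metric.tendsto_atTop] at h ⊢
  intro ε hε
  obtain ⟨N, hN⟩ := h (ε / 2 * (1 - a)) (by positivity)
  have hk (k : ℕ) : |x (N + k) - l| ≤ a ^ k * |x N - l| + ε / 2 := by
    induction k with
    | zero => simp; positivity
    | succ k ih =>
      have h1 := (hN (N + k) (by omega)).le
      rw [Real.dist_eq] at h1
      have h2 : x (N + (k + 1)) - l =
          a * (x (N + k) - l) + (x (N + k + 1) - a * x (N + k) - c) := by
        rw [← hlc, ← Nat.add_assoc]; ring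
      rw [h2]
      refine (abs_add_le _ _).trans ?_
      rw [abs_mul, abs_of_nonneg ha0, pow_succ]
      nlinarith [mul_le_mul_of_nonneg_left ih ha0]
  have hlim : Tendsto (fun k : ℕ => a ^ k * |x N - l|) atTop (𝓝 0) := by
    simpa using (tendsto_pow_atTop_nhds_zero_of_lt_one ha0 ha1).mul_const |x N - l|
  obtain ⟨K, hK⟩ := eventually_atTop.mp (hlim.eventually (gt_mem_nhds (half_pos hε)))
  refine ⟨N + K, fun n hn => ?_⟩
  obtain ⟨k, rfl⟩ := Nat.exists_eq_add_of_le (show N ≤ n by omega)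
  rw [Real.dist_eq]
  have h1 := hK k (by omega)
  have h2 := hk k
  linarith

lemma tendsto_factorial_halfRatio_moment : Tendsto (fun n : ℕ =>
    (((n + 2)! : ℝ) * halfRatio (n + 2)) ^ 4 * moment 0 (n + 1) * moment 0 (n + 2)) atTop
    (𝓝 (1 / π ^ 2)) := by
  have h1 := (tendsto_add_atTop_iff_nat 2).mpr tendsto_mul_halfRatio_sq
  have h2 := (tendsto_add_atTop_iff_nat 1).mpr tendsto_factorial_sq_mul_moment_zero
  have h3 := (tendsto_add_atTop_iff_nat 2).mpr tendsto_factorial_sq_mul_moment_zero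
  have h := ((h1.pow 2).mul h2).mul h3
  rw [one_div_pow, mul_one, mul_one] at h
  refine h.congr fun n => ?_
  rw [Nat.factorial_succ (n + 1)]
  push_cast
  ring

lemma tendsto_remainder_div_denominator {p q : ℕ → ℝ}
    (hp : ∀ n : ℕ, p (n + 2) =
      (40 * (n + 2 : ℝ) ^ 2 + 2) * p (n + 1) - 9 * (2 * (n : ℝ) + 3) ^ 4 * p n)
    (hq : ∀ n : ℕ, q (n + 2) =
      (40 * (n + 2 : ℝ) ^ 2 + 2) * q (n + 1) - 9 * (2 * (n : ℝ) + 3) ^ 4 * q n)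
    (hp0 : p 0 = 36) (hp1 : p 1 = 1512) (hq0 : q 0 = 1) (hq1 : q 1 = 33) :
    Tendsto (fun n => (cfLimit - p n / q n) * 9 ^ n) atTop (𝓝 (4 * cfLimit / 9)) := by
  have hqpos (n : ℕ) : 0 < q n := (denominator_growth hq hq0 hq1 n).1
  set κ := cfLimit / (4 * moment 0 0) with hκdef
  have hF := moment_zero_pos 0
  have hL := cfLimit_pos
  have hκ : 0 < κ := by positivity
  have hr (n : ℕ) : cfLimit * q n - p n = κ * minimalSolution (n + 1) := by
    refine eq_mul_minimalSolution (u := fun n => cfLimit * q n - p n) (fun n => ?_) ?_ ?_ n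
    · rw [hp, hq]; ring
    · rw [hp0, hq0]; ring
    · rw [hp1, hq1]; ring
  have hrpos (n : ℕ) : 0 < cfLimit * q n - p n := by
    rw [hr]; exact mul_pos hκ (minimalSolution_pos _)
  have hcas := casoratian hp hq (by rw [hp0, hp1, hq0, hq1]; norm_num)
  have hstep (n : ℕ) : 9 / (16 * κ ^ 2) * ((((n + 2)! : ℝ) * halfRatio (n + 2)) ^ 4 *
        moment 0 (n + 1) * moment 0 (n + 2))⁻¹ =
      q (n + 1) / (cfLimit * q (n + 1) - p (n + 1)) / 9 ^ (n + 1) -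
        1 / 9 * (q n / (cfLimit * q n - p n) / 9 ^ n) := by
    have h1 : q (n + 1) / (cfLimit * q (n + 1) - p (n + 1)) / 9 ^ (n + 1) -
        1 / 9 * (q n / (cfLimit * q n - p n) / 9 ^ n) =
        (p (n + 1) * q n - p n * q (n + 1)) /
          ((cfLimit * q n - p n) * (cfLimit * q (n + 1) - p (n + 1)) * 9 ^ (n + 1)) := by
      have h2 := (hrpos n).ne'
      have h3 := (hrpos (n + 1)).ne'
      obtain ⟨A, hA⟩ : ∃ A, A = cfLimit * q n - p n := ⟨_, rfl⟩
      obtain ⟨B, hB⟩ : ∃ B, B = cfLimit * q (n + 1) - p (n + 1) := ⟨_, rfl⟩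
      rw [← hA] at h2 ⊢
      rw [← hB] at h3 ⊢
      rw [pow_succ]
      field_simp
      rw [hA, hB]
      ring
    rw [h1, hcas, hr, hr, minimalSolution, minimalSolution]
    have h2 := (moment_zero_pos (n + 1)).ne'
    have h3 := (moment_zero_pos (n + 2)).ne'
    have h4 := (halfRatio_pos (n + 1)).ne'
    have h5 := (halfRatio_pos (n + 2)).ne'
    have e : (144 : ℝ) ^ (n + 1) = 9 ^ (n + 1) * 4 ^ (n + 1) * 4 ^ (n + 1) := by
      rw [← mul_pow, ← mul_pow]; norm_num
    rw [e, pow_succ (4 : ℝ) (n + 1)]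
    field_simp
    norm_num
  have hlim : Tendsto (fun n => q n / (cfLimit * q n - p n) / 9 ^ n) atTop
      (𝓝 (9 / (4 * cfLimit))) := by
    have h := tendsto_of_tendsto_sub_mul (a := 1 / 9)
      (x := fun n => q n / (cfLimit * q n - p n) / 9 ^ n) (by norm_num) (by norm_num)
      (((tendsto_factorial_halfRatio_moment.inv₀ (by positivity)).const_mul
        (9 / (16 * κ ^ 2))).congr hstep)
    convert h using 2
    rw [hκdef]
    have := cfLimit_eq
    field_simp
    linear_combination 128 * this
  have h := hlim.inv₀ (by positivity)
  rw [inv_div] at h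
  refine h.congr fun n => ?_
  have h1 := (hrpos n).ne'
  have h2 := (hqpos n).ne'
  rw [sub_div' h2]
  field_simp

end ShiftedChi3

/-- The continued fraction `[[36,33,40n²+2],[324,-9(2n+1)⁴]]` converges to
`2^{-1/3}(Γ(1/3)/Γ(2/3))⁶`, with speed `4·2^{-1/3}(Γ(1/3)/Γ(2/3))⁶/3^(2n+2)`. -/
theorem shifted_L_chi3_cf (p q : ℕ → ℝ)
    (hp : ∀ n : ℕ, 2 ≤ n →
      p n = (40 * (n : ℝ) ^ 2 + 2) * p (n - 1) - 9 * (2 * (n : ℝ) - 1) ^ 4 * p (n - 2))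
    (hq : ∀ n : ℕ, 2 ≤ n →
      q n = (40 * (n : ℝ) ^ 2 + 2) * q (n - 1) - 9 * (2 * (n : ℝ) - 1) ^ 4 * q (n - 2))
    (hp0 : p 0 = 36) (hp1 : p 1 = 1512) (hq0 : q 0 = 1) (hq1 : q 1 = 33) :
    (∀ n, q n ≠ 0) ∧
    Tendsto (fun n => p n / q n) atTop
      (nhds ((2 : ℝ) ^ (-(1 : ℝ) / 3) * (Real.Gamma (1 / 3) / Real.Gamma (2 / 3)) ^ 6)) ∧
    (fun n : ℕ =>
        (2 : ℝ) ^ (-(1 : ℝ) / 3) * (Real.Gamma (1 / 3) / Real.Gamma (2 / 3)) ^ 6 - p n / q n)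
      ~[atTop]
      (fun n : ℕ =>
        4 * ((2 : ℝ) ^ (-(1 : ℝ) / 3) * (Real.Gamma (1 / 3) / Real.Gamma (2 / 3)) ^ 6)
          / 3 ^ (2 * n + 2)) := by
  have shift {u : ℕ → ℝ} (hu : ∀ n : ℕ, 2 ≤ n →
      u n = (40 * (n : ℝ) ^ 2 + 2) * u (n - 1) - 9 * (2 * (n : ℝ) - 1) ^ 4 * u (n - 2)) (n : ℕ) :
      u (n + 2) = (40 * (n + 2 : ℝ) ^ 2 + 2) * u (n + 1) - 9 * (2 * (n : ℝ) + 3) ^ 4 * u n := by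
    have := hu (n + 2) (by omega)
    rw [show n + 2 - 1 = n + 1 by omega, Nat.add_sub_cancel] at this
    rw [this]
    push_cast
    ring
  rw [← ShiftedChi3.cfLimit]
  have hL := ShiftedChi3.cfLimit_pos
  have key := ShiftedChi3.tendsto_remainder_div_denominator (shift hp) (shift hq) hp0 hp1 hq0 hq1
  have h9 : Tendsto (fun n : ℕ => ((1 : ℝ) / 9) ^ n) atTop (nhds 0) :=
    tendsto_pow_atTop_nhds_zero_of_lt_one (by norm_num) (by norm_num)
  have hpow (n : ℕ) : (9 : ℝ) ^ n * (1 / 9) ^ n = 1 := by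
    rw [← mul_pow]; norm_num
  refine ⟨fun n => (ShiftedChi3.denominator_growth (shift hq) hq0 hq1 n).1.ne', ?_, ?_⟩
  · have h := (key.mul h9).const_sub ShiftedChi3.cfLimit
    rw [mul_zero, sub_zero] at h
    refine h.congr fun n => ?_
    rw [mul_assoc, hpow, mul_one, sub_sub_cancel]
  · rw [isEquivalent_iff_tendsto_one (Eventually.of_forall fun n => by positivity)]
    have h := key.div_const (4 * ShiftedChi3.cfLimit / 9)
    rw [div_self (by positivity)] at h
    refine h.congr fun n => ?_
    have e : (3 : ℝ) ^ (2 * n + 2) = 9 ^ n * 9 := by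
      rw [pow_add, pow_mul]; norm_num
    rw [Pi.div_apply, e]
    field_simp
end
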